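/- arXiv:2409.10051 — 2 statements merged into one kernel-verified Lean document; each statement's English description precedes it below -/
import Mathlib

section
/- Let θ ∈ [0,1), let (n_j)_{j≥1} be a nondecreasing unbounded sequence of reals with n_1 = 1, and let F(s) = ∑_j a_j n_j^{−s} have non-negative coefficients a_j whose counting function satisfies A(x) := ∑_{n_j ≤ x} a_j = x·P(log x) + E(x) with P a polynomial of degree d and E(x) ≪ x^θ (log x)^q. Then F extends analytically to {Re s > θ} \ {1}, and for every δ > 0 the continuation satisfies F(σ + it) ≪_δ |t|^{(1−σ)/(1−θ)} (log |t|)^{max{d, q}} uniformly for θ + δ ≤ σ ≤ 1 − δ and |t| ≥ 2, and F(σ + it) ≪ |t|^{(1−σ)/(1−θ)} (log |t|)^{max{d+1, q}} + (log |t|)^{d+1} uniformly for σ ≥ (1+θ)/2 and |t| ≥ 2. -/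
open Filter Asymptotics
open MeasureTheory

/-- The summatory function of the weights `a` at the frequencies `n`. -/
noncomputable def countingFn (n a : ℕ → ℝ) (x : ℝ) : ℝ :=
  ∑' j : ℕ, Set.indicator {j : ℕ | n j ≤ x} a j

/-- The deviation of the summatory function from `x * P (log x)`. -/
noncomputable def remainder (n a : ℕ → ℝ) (P : Polynomial ℝ) (x : ℝ) : ℝ :=
  countingFn n a x - x * P.eval (Real.log x)

/-- `∫ v in u..∞, P v * exp (-(s - 1) * (v - u))`, in closed form. -/
noncomputable def polarPart (P : Polynomial ℝ) (s : ℂ) (u : ℝ) : ℂ :=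
  ∑ k ∈ Finset.range (P.natDegree + 1),
    (((Polynomial.derivative^[k] P).eval u : ℝ) : ℂ) / (s - 1) ^ (k + 1)

/-- The analytic continuation of the Dirichlet series `∑ a j * n j ^ (-s)`. -/
noncomputable def continuation (n a : ℕ → ℝ) (P : Polynomial ℝ) (s : ℂ) : ℂ :=
  s * polarPart P s 0 +
    s * mellin ((Set.Ioi 1).indicator fun x => (remainder n a P x : ℂ)) (-s)

theorem finite_setOf_le {n : ℕ → ℝ} (hunb : Tendsto n atTop atTop) (x : ℝ) :
    {j | n j ≤ x}.Finite := by
  have h := hunb.eventually (eventually_gt_atTop x)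
  rw [← Nat.cofinite_eq_atTop] at h
  simpa [Filter.eventually_cofinite] using h

theorem countingFn_eq_sum {n a : ℕ → ℝ} (T : Finset ℕ) {x : ℝ}
    (hT : ∀ j, n j ≤ x → j ∈ T) :
    countingFn n a x = ∑ j ∈ T, if n j ≤ x then a j else 0 := by
  unfold countingFn
  rw [tsum_eq_sum (s := T)]
  · refine Finset.sum_congr rfl fun j _ => ?_
    simp [Set.indicator_apply]
  · intro j hj
    have : ¬ n j ≤ x := fun h => hj (hT j h)
    simp [this]

theorem countingFn_monotone {n a : ℕ → ℝ} (hunb : Tendsto n atTop atTop)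
    (hapos : ∀ j, 0 ≤ a j) : Monotone (countingFn n a) := by
  intro x y hxy
  have hy := finite_setOf_le hunb y
  rw [countingFn_eq_sum hy.toFinset (x := x) (by intro j hj; simpa using hj.trans hxy),
    countingFn_eq_sum hy.toFinset (x := y) (by intro j hj; simpa using hj)]
  refine Finset.sum_le_sum fun j _ => ?_
  have := hapos j
  split_ifs <;> linarith

theorem countingFn_nonneg {n a : ℕ → ℝ} (hapos : ∀ j, 0 ≤ a j) (x : ℝ) :
    0 ≤ countingFn n a x :=
  tsum_nonneg fun j => Set.indicator_nonneg (fun j _ => hapos j) j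

theorem intervalIntegrable_cpow_of_one_le {X y : ℝ} (r : ℂ) (hy : 1 ≤ y) (hX : 1 ≤ X) :
    IntervalIntegrable (fun x : ℝ => (x : ℂ) ^ r) volume y X := by
  apply intervalIntegral.intervalIntegrable_cpow
  right
  intro h
  have := Set.mem_uIcc.1 h
  rcases this with h | h <;> linarith

theorem integral_step_mul_cpow {y X : ℝ} (hy : 1 ≤ y) (hX : y ≤ X) {s : ℂ} (hs : s ≠ 0)
    (c : ℝ) :
    IntervalIntegrable (fun x : ℝ => ((if y ≤ x then c else 0 : ℝ) : ℂ) * (x : ℂ) ^ (-s - 1))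
      volume 1 X ∧
    s * ∫ x in (1 : ℝ)..X, ((if y ≤ x then c else 0 : ℝ) : ℂ) * (x : ℂ) ^ (-s - 1) =
      c * (y : ℂ) ^ (-s) - c * (X : ℂ) ^ (-s) := by
  have h1 : Set.EqOn (fun _ : ℝ => (0 : ℂ))
      (fun x : ℝ => ((if y ≤ x then c else 0 : ℝ) : ℂ) * (x : ℂ) ^ (-s - 1))
      (Set.Ioo 1 y) := by
    intro x hx
    simp [not_le.2 hx.2]
  have h2 : Set.EqOn (fun x : ℝ => (c : ℂ) * (x : ℂ) ^ (-s - 1))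
      (fun x : ℝ => ((if y ≤ x then c else 0 : ℝ) : ℂ) * (x : ℂ) ^ (-s - 1))
      (Set.Ioc y X) := by
    intro x hx
    simp [hx.1.le]
  have i1 : IntervalIntegrable
      (fun x : ℝ => ((if y ≤ x then c else 0 : ℝ) : ℂ) * (x : ℂ) ^ (-s - 1)) volume 1 y := by
    rw [intervalIntegrable_iff_integrableOn_Ioo_of_le hy]
    exact (integrableOn_zero).congr_fun h1 measurableSet_Ioo
  have i2 : IntervalIntegrable
      (fun x : ℝ => ((if y ≤ x then c else 0 : ℝ) : ℂ) * (x : ℂ) ^ (-s - 1)) volume y X := by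
    have := (intervalIntegrable_cpow_of_one_le (-s - 1) hy (hy.trans hX)).const_mul (c : ℂ)
    rw [intervalIntegrable_iff_integrableOn_Ioc_of_le hX] at this ⊢
    exact this.congr_fun h2 measurableSet_Ioc
  refine ⟨i1.trans i2, ?_⟩
  rw [← intervalIntegral.integral_add_adjacent_intervals i1 i2,
    intervalIntegral.integral_of_le hy, intervalIntegral.integral_of_le hX,
    integral_Ioc_eq_integral_Ioo, ← setIntegral_congr_fun measurableSet_Ioo h1,
    ← setIntegral_congr_fun measurableSet_Ioc h2, ← intervalIntegral.integral_of_le hX,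
    intervalIntegral.integral_const_mul, integral_cpow]
  · have : -s - 1 + 1 = -s := by ring
    rw [this]
    simp only [integral_zero, zero_add]
    field_simp
    ring
  · right
    refine ⟨fun h => hs (by linear_combination -h), fun h => ?_⟩
    rcases Set.mem_uIcc.1 h with h | h <;> linarith

theorem partial_summation {n a : ℕ → ℝ} (hunb : Tendsto n atTop atTop) (hn : ∀ j, 1 ≤ n j)
    {X : ℝ} (hX : 1 ≤ X) {s : ℂ} (hs : s ≠ 0) :
    IntervalIntegrable (fun x : ℝ => (countingFn n a x : ℂ) * (x : ℂ) ^ (-s - 1)) volume 1 X ∧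
    ∑ j ∈ (finite_setOf_le hunb X).toFinset, (a j : ℂ) * (n j : ℂ) ^ (-s) =
      countingFn n a X * (X : ℂ) ^ (-s) +
        s * ∫ x in (1 : ℝ)..X, (countingFn n a x : ℂ) * (x : ℂ) ^ (-s - 1) := by
  set T := (finite_setOf_le hunb X).toFinset with hT
  have hmem : ∀ j, j ∈ T ↔ n j ≤ X := by simp [hT]
  have hE : Set.EqOn
      (fun x : ℝ => ∑ j ∈ T, ((if n j ≤ x then a j else 0 : ℝ) : ℂ) * (x : ℂ) ^ (-s - 1))
      (fun x : ℝ => (countingFn n a x : ℂ) * (x : ℂ) ^ (-s - 1)) (Set.uIoc 1 X) := by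
    intro x hx
    rw [Set.uIoc_of_le hX] at hx
    simp only
    rw [countingFn_eq_sum T (x := x) (fun j hj => (hmem j).2 (hj.trans hx.2)),
      Complex.ofReal_sum, Finset.sum_mul]
  have hj := fun j (h : j ∈ T) => integral_step_mul_cpow (hn j) ((hmem j).1 h) hs (a j)
  constructor
  · refine (IntervalIntegrable.sum T fun j h => (hj j h).1).congr ?_
    intro x hx
    simpa using hE hx
  · have hAX : countingFn n a X = ∑ j ∈ T, a j := by
      rw [countingFn_eq_sum T (x := X) (fun j h => (hmem j).2 h)]
      exact Finset.sum_congr rfl fun j h => if_pos ((hmem j).1 h)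
    rw [← intervalIntegral.integral_congr_ae (Eventually.of_forall fun x hx => hE hx),
      intervalIntegral.integral_finsetSum fun j h => (hj j h).1, Finset.mul_sum,
      Finset.sum_congr rfl fun j h => (hj j h).2, Finset.sum_sub_distrib, hAX,
      Complex.ofReal_sum, Finset.sum_mul]
    ring

theorem polarPart_hasDerivAt (P : Polynomial ℝ) {s : ℂ} (hs : s ≠ 1) (u : ℝ) :
    HasDerivAt (polarPart P s) ((s - 1) * polarPart P s u - P.eval u) u := by
  have hs' : s - 1 ≠ 0 := sub_ne_zero.2 hs
  have h1 : HasDerivAt (polarPart P s) (∑ k ∈ Finset.range (P.natDegree + 1),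
    (((Polynomial.derivative^[k + 1] P).eval u : ℝ) : ℂ) / (s - 1) ^ (k + 1)) u := by
    unfold polarPart
    apply HasDerivAt.fun_sum
    intro k _
    apply HasDerivAt.div_const
    rw [Function.iterate_succ_apply']
    exact ((Polynomial.derivative^[k] P).hasDerivAt u).ofReal_comp
  convert h1 using 1
  have h2 := Finset.sum_range_sub'
    (fun k => (((Polynomial.derivative^[k] P).eval u : ℝ) : ℂ) / (s - 1) ^ k) (P.natDegree + 1)
  rw [Polynomial.iterate_derivative_eq_zero (Nat.lt_succ_self _), Finset.sum_sub_distrib] at h2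
  simp only [Function.iterate_zero, id, pow_zero, div_one, Polynomial.eval_zero,
    Complex.ofReal_zero, zero_div, sub_zero] at h2
  rw [← h2]
  unfold polarPart
  rw [Finset.mul_sum, sub_sub_eq_add_sub, sub_eq_iff_eq_add, add_comm]
  congr 1
  refine Finset.sum_congr rfl fun k _ => ?_
  rw [pow_succ]
  field_simp

theorem integral_eval_log_mul_cpow (P : Polynomial ℝ) {s : ℂ} (hs : s ≠ 1) {X : ℝ}
    (hX : 1 ≤ X) :
    IntervalIntegrable (fun x : ℝ => ((x * P.eval (Real.log x) : ℝ) : ℂ) * (x : ℂ) ^ (-s - 1))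
      volume 1 X ∧
    ∫ x in (1 : ℝ)..X, ((x * P.eval (Real.log x) : ℝ) : ℂ) * (x : ℂ) ^ (-s - 1) =
      polarPart P s 0 - (X : ℂ) ^ (1 - s) * polarPart P s (Real.log X) := by
  have hpos : ∀ x ∈ Set.uIcc 1 X, 0 < x := by
    intro x hx
    rw [Set.uIcc_of_le hX] at hx
    linarith [hx.1]
  have hI : IntervalIntegrable
      (fun x : ℝ => ((x * P.eval (Real.log x) : ℝ) : ℂ) * (x : ℂ) ^ (-s - 1)) volume 1 X := by
    apply ContinuousOn.intervalIntegrable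
    intro x hx
    have h0 := hpos x hx
    apply ContinuousAt.continuousWithinAt
    refine ContinuousAt.mul ?_ (Complex.continuousAt_ofReal_cpow_const _ _ (Or.inr h0.ne'))
    exact Complex.continuous_ofReal.continuousAt.comp (continuousAt_id.mul
      (P.continuous.continuousAt.comp (Real.continuousAt_log h0.ne')))
  refine ⟨hI, ?_⟩
  have hd : ∀ x ∈ Set.uIcc 1 X, HasDerivAt
      (fun x : ℝ => -((x : ℂ) ^ (1 - s) * polarPart P s (Real.log x)))
      (((x * P.eval (Real.log x) : ℝ) : ℂ) * (x : ℂ) ^ (-s - 1)) x := by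
    intro x hx
    have h0 := hpos x hx
    have hx0 : (x : ℂ) ≠ 0 := by exact_mod_cast h0.ne'
    have e1 : HasDerivAt (fun x : ℝ => (x : ℂ) ^ (1 - s)) ((1 - s) * (x : ℂ) ^ (-s)) x := by
      have := hasDerivAt_ofReal_cpow_const h0.ne' (sub_ne_zero.2 (Ne.symm hs))
      rwa [show 1 - s - 1 = -s by ring] at this
    have e2 := (polarPart_hasDerivAt P hs (Real.log x)).scomp x (Real.hasDerivAt_log h0.ne')
    refine HasDerivAt.congr_deriv (e1.mul e2).neg ?_
    have a1 : (x : ℂ) ^ (1 - s) = x * (x : ℂ) ^ (-s) := by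
      rw [sub_eq_add_neg, Complex.cpow_add _ _ hx0, Complex.cpow_one]
    have a2 : (x : ℂ) ^ (-s - 1) = (x : ℂ) ^ (-s) / x := by
      rw [Complex.cpow_sub _ _ hx0, Complex.cpow_one]
    rw [a1, a2, Complex.real_smul]
    push_cast
    simp only [Function.comp]
    field_simp
    ring
  rw [intervalIntegral.integral_eq_sub_of_hasDerivAt hd hI]
  simp
  ring

theorem log_rpow_le (q : ℝ) {ε : ℝ} (hε : 0 < ε) :
    ∃ K : ℝ, 0 ≤ K ∧ ∀ X x : ℝ, 2 ≤ X → X ≤ x →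
      Real.log x ^ q ≤ K * Real.log X ^ q * (x / X) ^ ε := by
  have hl2 : 0 < Real.log 2 := Real.log_pos one_lt_two
  rcases le_or_gt q 0 with hq | hq
  · refine ⟨1, zero_le_one, fun X x hX hx => ?_⟩
    have hlX : 0 < Real.log X := Real.log_pos (by linarith)
    have h1 : Real.log x ^ q ≤ Real.log X ^ q :=
      Real.rpow_le_rpow_of_nonpos hlX (Real.log_le_log (by linarith) hx) hq
    have h2 : 1 ≤ (x / X) ^ ε :=
      Real.one_le_rpow ((one_le_div (by linarith)).2 hx) hε.le
    have h3 : 0 ≤ Real.log X ^ q := Real.rpow_nonneg hlX.le _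
    nlinarith
  · refine ⟨(1 + q / (ε * Real.log 2)) ^ q, by positivity, fun X x hX hx => ?_⟩
    have hX0 : 0 < X := by linarith
    have hlX : Real.log 2 ≤ Real.log X := Real.log_le_log two_pos hX
    have hlX0 : 0 < Real.log X := hl2.trans_le hlX
    have hr : 1 ≤ x / X := (one_le_div hX0).2 hx
    have hr0 : 0 < x / X := by linarith
    have hlogx : Real.log x = Real.log X + Real.log (x / X) := by
      rw [Real.log_div (by linarith) hX0.ne']; ring
    have hp : 1 ≤ (x / X) ^ (ε / q) := Real.one_le_rpow hr (by positivity)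
    have h1 := Real.log_le_rpow_div hr0.le (div_pos hε hq)
    have h2 : Real.log x ≤ Real.log X * ((1 + q / (ε * Real.log 2)) * (x / X) ^ (ε / q)) := by
      have h3 : Real.log (x / X) ≤ Real.log X * (q / (ε * Real.log 2) * (x / X) ^ (ε / q)) := by
        calc Real.log (x / X) ≤ (x / X) ^ (ε / q) / (ε / q) := h1
          _ = Real.log 2 * (q / (ε * Real.log 2) * (x / X) ^ (ε / q)) := by field_simp
          _ ≤ _ := by gcongr
      rw [hlogx]
      nlinarith
    calc Real.log x ^ q ≤
          (Real.log X * ((1 + q / (ε * Real.log 2)) * (x / X) ^ (ε / q))) ^ q := by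
          apply Real.rpow_le_rpow _ h2 hq.le
          exact Real.log_nonneg (by linarith)
      _ = (1 + q / (ε * Real.log 2)) ^ q * Real.log X ^ q * (x / X) ^ ε := by
          rw [Real.mul_rpow hlX0.le (by positivity), Real.mul_rpow (by positivity) (by positivity),
            ← Real.rpow_mul hr0.le, div_mul_cancel₀ _ hq.ne']
          ring

theorem abs_eval_le_one_add_pow {R : Polynomial ℝ} {d : ℕ} (hR : R.natDegree ≤ d) :
    ∃ B : ℝ, 0 ≤ B ∧ ∀ u : ℝ, 0 ≤ u → |R.eval u| ≤ B * (1 + u) ^ d := by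
  refine ⟨∑ i ∈ Finset.range (d + 1), |R.coeff i|,
    Finset.sum_nonneg fun _ _ => abs_nonneg _, fun u hu => ?_⟩
  rw [Polynomial.eval_eq_sum_range' (Nat.lt_succ_of_le hR), Finset.sum_mul]
  refine (Finset.abs_sum_le_sum_abs _ _).trans (Finset.sum_le_sum fun i hi => ?_)
  rw [abs_mul, abs_of_nonneg (pow_nonneg hu i)]
  refine mul_le_mul_of_nonneg_left ?_ (abs_nonneg _)
  calc u ^ i ≤ (1 + u) ^ i := by gcongr; linarith
    _ ≤ (1 + u) ^ d := by
      gcongr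
      · linarith
      · exact Nat.le_of_lt_succ (Finset.mem_range.1 hi)

theorem norm_polarPart_le (P : Polynomial ℝ) :
    ∃ B : ℝ, 0 ≤ B ∧ ∀ (s : ℂ) (u : ℝ), 0 ≤ u →
      ‖polarPart P s u‖ ≤ B * (1 + u) ^ P.natDegree *
        ∑ k ∈ Finset.range (P.natDegree + 1), (1 / ‖s - 1‖) ^ (k + 1) := by
  have h := fun k : ℕ => abs_eval_le_one_add_pow (R := Polynomial.derivative^[k] P)
    ((Polynomial.natDegree_iterate_derivative P k).trans (Nat.sub_le _ _))
  choose B hB0 hB using h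
  refine ⟨∑ k ∈ Finset.range (P.natDegree + 1), B k, Finset.sum_nonneg fun k _ => hB0 k,
    fun s u hu => ?_⟩
  rw [Finset.mul_sum]
  refine (norm_sum_le _ _).trans (Finset.sum_le_sum fun k hk => ?_)
  rw [norm_div, norm_pow, Complex.norm_real, Real.norm_eq_abs, one_div, inv_pow, ← div_eq_mul_inv]
  gcongr
  refine (hB k u hu).trans ?_
  gcongr
  exact Finset.single_le_sum (fun k _ => hB0 k) hk

theorem exists_remainder_bound {n a : ℕ → ℝ} (hunb : Tendsto n atTop atTop)
    (hapos : ∀ j, 0 ≤ a j) {P : Polynomial ℝ} {θ q : ℝ}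
    (hA : remainder n a P =O[atTop] fun x : ℝ => x ^ θ * Real.log x ^ q) :
    ∃ C : ℝ, 0 ≤ C ∧ ∀ x : ℝ, 2 ≤ x →
      |remainder n a P x| ≤ C * (x ^ θ * Real.log x ^ q) := by
  obtain ⟨c, hc0, hc⟩ := hA.exists_nonneg
  obtain ⟨x₀, hx₀⟩ := eventually_atTop.1 hc.bound
  have hposg : ∀ x : ℝ, 2 ≤ x → 0 < x ^ θ * Real.log x ^ q := fun x hx =>
    mul_pos (Real.rpow_pos_of_pos (by linarith) _)
      (Real.rpow_pos_of_pos (Real.log_pos (by linarith)) _)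
  have hcont : ContinuousOn (fun x : ℝ => (countingFn n a x₀ + |x * P.eval (Real.log x)|) /
      (x ^ θ * Real.log x ^ q)) (Set.Icc 2 x₀) := by
    intro x hx
    have hx0 : x ≠ 0 := by linarith [hx.1]
    have hl : Real.log x ≠ 0 := (Real.log_pos (by linarith [hx.1])).ne'
    apply ContinuousAt.continuousWithinAt
    have hlog := Real.continuousAt_log hx0
    refine ContinuousAt.div ?_ ?_ (hposg x hx.1).ne'
    · exact continuousAt_const.add
        (continuousAt_id.mul (P.continuous.continuousAt.comp hlog)).abs
    · exact (Real.continuousAt_rpow_const _ _ (Or.inl hx0)).mul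
        (hlog.rpow_const (Or.inl hl))
  obtain ⟨M, hM⟩ := (isCompact_Icc.image_of_continuousOn hcont).bddAbove
  refine ⟨max c M, le_max_of_le_left hc0, fun x hx => ?_⟩
  have hg := hposg x hx
  rcases le_or_gt x₀ x with h | h
  · have := hx₀ x h
    rw [Real.norm_eq_abs, Real.norm_eq_abs, abs_of_pos hg] at this
    exact this.trans (mul_le_mul_of_nonneg_right (le_max_left _ _) hg.le)
  · have h1 : (countingFn n a x₀ + |x * P.eval (Real.log x)|) / (x ^ θ * Real.log x ^ q) ≤ M :=
      hM ⟨x, ⟨hx, h.le⟩, rfl⟩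
    have h2 := countingFn_monotone hunb hapos h.le
    have h3 := countingFn_nonneg (n := n) hapos x
    calc |remainder n a P x| ≤ |countingFn n a x| + |x * P.eval (Real.log x)| := abs_sub _ _
      _ ≤ countingFn n a x₀ + |x * P.eval (Real.log x)| := by
          rw [abs_of_nonneg h3]; gcongr
      _ ≤ M * (x ^ θ * Real.log x ^ q) := (div_le_iff₀ hg).1 h1
      _ ≤ _ := mul_le_mul_of_nonneg_right (le_max_right _ _) hg.le

theorem rpow_mul_log_rpow_le (θ q : ℝ) {ε : ℝ} (hε : 0 < ε) :
    ∃ K : ℝ, 0 ≤ K ∧ ∀ x : ℝ, 2 ≤ x → x ^ θ * Real.log x ^ q ≤ K * x ^ (θ + ε) := by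
  obtain ⟨K, hK0, hK⟩ := log_rpow_le q hε
  have hl2 : 0 < Real.log 2 := Real.log_pos one_lt_two
  refine ⟨K * Real.log 2 ^ q, by positivity, fun x hx => ?_⟩
  have hx0 : 0 < x := by linarith
  calc x ^ θ * Real.log x ^ q ≤ x ^ θ * (K * Real.log 2 ^ q * (x / 2) ^ ε) := by
        gcongr
        exact hK 2 x le_rfl hx
    _ ≤ x ^ θ * (K * Real.log 2 ^ q * x ^ ε) := by
        gcongr
        linarith
    _ = _ := by rw [Real.rpow_add hx0]; ring

theorem exists_countingFn_bound {n a : ℕ → ℝ} (hunb : Tendsto n atTop atTop)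
    (hapos : ∀ j, 0 ≤ a j) {P : Polynomial ℝ} {θ q : ℝ} (hθ : θ < 1)
    (hA : remainder n a P =O[atTop] fun x : ℝ => x ^ θ * Real.log x ^ q) :
    ∃ C : ℝ, 0 ≤ C ∧ ∀ x : ℝ, 1 ≤ x →
      countingFn n a x ≤ C * (x * (1 + Real.log x) ^ P.natDegree) := by
  obtain ⟨C, hC0, hC⟩ := exists_remainder_bound hunb hapos hA
  obtain ⟨K, hK0, hK⟩ := rpow_mul_log_rpow_le θ q (sub_pos.2 hθ)
  obtain ⟨B, hB0, hB⟩ := abs_eval_le_one_add_pow (le_refl P.natDegree)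
  have hA2 := countingFn_nonneg (n := n) hapos 2
  refine ⟨countingFn n a 2 + B + C * K, by positivity, fun x hx => ?_⟩
  have hlx := Real.log_nonneg hx
  have hp : 1 ≤ (1 + Real.log x) ^ P.natDegree := one_le_pow₀ (by linarith)
  have hxp : x ≤ x * (1 + Real.log x) ^ P.natDegree := le_mul_of_one_le_right (by linarith) hp
  rcases le_or_gt 2 x with h | h
  · have h1 := (le_abs_self _).trans ((hC x h).trans (mul_le_mul_of_nonneg_left (hK x h) hC0))
    rw [add_sub_cancel, Real.rpow_one] at h1
    have h2 := mul_le_mul_of_nonneg_left ((le_abs_self _).trans (hB _ hlx)) (by linarith : 0 ≤ x)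
    have h3 : C * (K * x) ≤ C * (K * (x * (1 + Real.log x) ^ P.natDegree)) := by gcongr
    have h4 : 0 ≤ countingFn n a 2 * (x * (1 + Real.log x) ^ P.natDegree) := by positivity
    unfold remainder at h1
    nlinarith
  · have h1 := countingFn_monotone hunb hapos h.le
    have h3 : 0 ≤ (B + C * K) * (x * (1 + Real.log x) ^ P.natDegree) := by positivity
    nlinarith

theorem indicator_remainder_locallyIntegrableOn {n a : ℕ → ℝ} (hunb : Tendsto n atTop atTop)
    (hapos : ∀ j, 0 ≤ a j) (P : Polynomial ℝ) :
    LocallyIntegrableOn ((Set.Ioi 1).indicator fun x => (remainder n a P x : ℂ))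
      (Set.Ioi 0) := by
  have h1 : LocallyIntegrableOn (fun x => countingFn n a x) (Set.Ioi 0) :=
    (countingFn_monotone hunb hapos).locallyIntegrable.locallyIntegrableOn _
  have h2 : LocallyIntegrableOn (fun x : ℝ => x * P.eval (Real.log x)) (Set.Ioi 0) := by
    refine ContinuousOn.locallyIntegrableOn (fun x hx => ?_) measurableSet_Ioi
    exact (continuousAt_id.mul (P.continuous.continuousAt.comp
      (Real.continuousAt_log (ne_of_gt hx)))).continuousWithinAt
  have h3 : LocallyIntegrableOn (fun x => (remainder n a P x : ℂ)) (Set.Ioi 0) := by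
    intro x hx
    obtain ⟨U, hU, hi⟩ := (h1.sub h2) x hx
    exact ⟨U, hU, hi.ofReal⟩
  intro x hx
  obtain ⟨U, hU, hi⟩ := h3 x hx
  exact ⟨U, hU, hi.indicator measurableSet_Ioi⟩

theorem indicator_remainder_isBigO_atTop {n a : ℕ → ℝ} {P : Polynomial ℝ} {θ q : ℝ}
    (hA : remainder n a P =O[atTop] fun x : ℝ => x ^ θ * Real.log x ^ q) {b : ℝ} (hb : θ < b) :
    ((Set.Ioi 1).indicator fun x => (remainder n a P x : ℂ)) =O[atTop] fun x : ℝ => x ^ b := by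
  obtain ⟨K, hK0, hK⟩ := rpow_mul_log_rpow_le θ q (sub_pos.2 hb)
  have h1 : (fun x : ℝ => x ^ θ * Real.log x ^ q) =O[atTop] fun x : ℝ => x ^ b := by
    refine IsBigO.of_bound K ?_
    filter_upwards [eventually_ge_atTop 2] with x hx
    have h0 : 0 ≤ x := by linarith
    have hl : 0 ≤ Real.log x := Real.log_nonneg (by linarith)
    have := hK x hx
    rw [add_sub_cancel] at this
    rwa [Real.norm_of_nonneg (by positivity), Real.norm_of_nonneg (by positivity)]
  refine IsBigO.trans ?_ (hA.trans h1)
  refine IsBigO.of_bound 1 (Eventually.of_forall fun x => ?_)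
  rw [one_mul]
  refine (norm_indicator_le_norm_self _ _).trans ?_
  simp

theorem indicator_Ioi_isBigO_nhdsGT_zero (f : ℝ → ℂ) (b : ℝ) :
    ((Set.Ioi 1).indicator f) =O[nhdsWithin 0 (Set.Ioi 0)] fun x : ℝ => x ^ b := by
  refine IsBigO.of_bound 0 ?_
  filter_upwards [Ioo_mem_nhdsGT (zero_lt_one' ℝ)] with x hx
  simp [not_lt.2 hx.2.le]

theorem remainder_mellinConvergent {n a : ℕ → ℝ} (hunb : Tendsto n atTop atTop)
    (hapos : ∀ j, 0 ≤ a j) {P : Polynomial ℝ} {θ q : ℝ}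
    (hA : remainder n a P =O[atTop] fun x : ℝ => x ^ θ * Real.log x ^ q)
    {s : ℂ} (hs : s.re < -θ) :
    MellinConvergent ((Set.Ioi 1).indicator fun x => (remainder n a P x : ℂ)) s ∧
    DifferentiableAt ℂ
      (mellin ((Set.Ioi 1).indicator fun x => (remainder n a P x : ℂ))) s := by
  have h1 := indicator_remainder_locallyIntegrableOn hunb hapos P
  have h2 := indicator_remainder_isBigO_atTop hA (b := -((s.re - θ) / 2)) (by linarith)
  have h3 := indicator_Ioi_isBigO_nhdsGT_zero (fun x => (remainder n a P x : ℂ)) (-(s.re - 1))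
  exact ⟨mellinConvergent_of_isBigO_rpow h1 h2 (by linarith) h3 (by linarith),
    mellin_differentiableAt_of_isBigO_rpow h1 h2 (by linarith) h3 (by linarith)⟩

theorem continuation_differentiableOn {n a : ℕ → ℝ} (hunb : Tendsto n atTop atTop)
    (hapos : ∀ j, 0 ≤ a j) {P : Polynomial ℝ} {θ q : ℝ}
    (hA : remainder n a P =O[atTop] fun x : ℝ => x ^ θ * Real.log x ^ q) :
    DifferentiableOn ℂ (continuation n a P) {s : ℂ | θ < s.re ∧ s ≠ 1} := by
  intro s hs
  apply DifferentiableAt.differentiableWithinAt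
  have hs1 : s - 1 ≠ 0 := sub_ne_zero.2 hs.2
  have h1 : DifferentiableAt ℂ (fun s => polarPart P s 0) s := by
    unfold polarPart
    refine DifferentiableAt.fun_sum fun k _ => ?_
    exact (differentiableAt_const _).div
      ((differentiableAt_id.sub_const 1).pow _) (pow_ne_zero _ hs1)
  have h2 := (remainder_mellinConvergent hunb hapos hA (s := -s)
    (by simpa using hs.1)).2
  have h3 : DifferentiableAt ℂ (fun s : ℂ =>
      mellin ((Set.Ioi 1).indicator fun x => (remainder n a P x : ℂ)) (-s)) s :=
    DifferentiableAt.comp (g := mellin _) s h2 differentiableAt_id.neg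
  exact (differentiableAt_id.mul h1).add (differentiableAt_id.mul h3)

theorem remainder_integrableOn {n a : ℕ → ℝ} (hunb : Tendsto n atTop atTop)
    (hapos : ∀ j, 0 ≤ a j) {P : Polynomial ℝ} {θ q : ℝ}
    (hA : remainder n a P =O[atTop] fun x : ℝ => x ^ θ * Real.log x ^ q)
    {s : ℂ} (hs : θ < s.re) :
    IntegrableOn (fun x : ℝ => (remainder n a P x : ℂ) * (x : ℂ) ^ (-s - 1)) (Set.Ioi 1) ∧
    mellin ((Set.Ioi 1).indicator fun x => (remainder n a P x : ℂ)) (-s) =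
      ∫ x in Set.Ioi (1 : ℝ), (remainder n a P x : ℂ) * (x : ℂ) ^ (-s - 1) := by
  have h := (remainder_mellinConvergent hunb hapos hA (s := -s) (by simpa using hs)).1
  have he : (fun t : ℝ => (t : ℂ) ^ (-s - 1) •
      (Set.Ioi 1).indicator (fun x => (remainder n a P x : ℂ)) t) =
      (Set.Ioi 1).indicator
        (fun x : ℝ => (remainder n a P x : ℂ) * (x : ℂ) ^ (-s - 1)) := by
    funext t
    by_cases ht : t ∈ Set.Ioi (1 : ℝ) <;> simp [ht, mul_comm]
  have hsub : Set.Ioi (0 : ℝ) ∩ Set.Ioi 1 = Set.Ioi 1 :=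
    Set.inter_eq_right.2 (Set.Ioi_subset_Ioi zero_le_one)
  have hsub' : Set.Ioi (1 : ℝ) ∩ Set.Ioi 0 = Set.Ioi 1 := by rw [Set.inter_comm, hsub]
  unfold MellinConvergent at h
  unfold mellin
  rw [he] at h ⊢
  rw [setIntegral_indicator measurableSet_Ioi, hsub]
  rw [IntegrableOn, integrable_indicator_iff measurableSet_Ioi, IntegrableOn,
    Measure.restrict_restrict measurableSet_Ioi, hsub'] at h
  exact ⟨h, rfl⟩

theorem continuation_eq {n a : ℕ → ℝ} (hunb : Tendsto n atTop atTop) (hn : ∀ j, 1 ≤ n j)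
    (hapos : ∀ j, 0 ≤ a j) {P : Polynomial ℝ} {θ q : ℝ} (hθ : 0 ≤ θ)
    (hA : remainder n a P =O[atTop] fun x : ℝ => x ^ θ * Real.log x ^ q)
    {s : ℂ} (hs : θ < s.re) (hs1 : s ≠ 1) {X : ℝ} (hX : 1 ≤ X) :
    continuation n a P s =
      ∑ j ∈ (finite_setOf_le hunb X).toFinset, (a j : ℂ) * (n j : ℂ) ^ (-s) +
        (s * ((X : ℂ) ^ (1 - s) * polarPart P s (Real.log X)) -
          countingFn n a X * (X : ℂ) ^ (-s) +
          s * ∫ x in Set.Ioi X, (remainder n a P x : ℂ) * (x : ℂ) ^ (-s - 1)) := by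
  have hs0 : s ≠ 0 := by
    rintro rfl
    simp at hs
    linarith
  obtain ⟨hi, hm⟩ := remainder_integrableOn hunb hapos hA hs
  obtain ⟨hiA, hS⟩ := partial_summation (a := a) hunb hn hX hs0
  obtain ⟨hiP, hP⟩ := integral_eval_log_mul_cpow P hs1 hX
  have hsplit := setIntegral_union (Set.Ioc_disjoint_Ioi (le_refl X)) measurableSet_Ioi
    (hi.mono_set Set.Ioc_subset_Ioi_self) (hi.mono_set (Set.Ioi_subset_Ioi hX))
  rw [Set.Ioc_union_Ioi_eq_Ioi hX, ← intervalIntegral.integral_of_le hX] at hsplit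
  have hsub : ∫ x in (1 : ℝ)..X, (remainder n a P x : ℂ) * (x : ℂ) ^ (-s - 1) =
      (∫ x in (1 : ℝ)..X, (countingFn n a x : ℂ) * (x : ℂ) ^ (-s - 1)) -
        ∫ x in (1 : ℝ)..X, ((x * P.eval (Real.log x) : ℝ) : ℂ) * (x : ℂ) ^ (-s - 1) := by
    rw [← intervalIntegral.integral_sub hiA hiP]
    congr 1
    funext x
    unfold remainder
    push_cast
    ring
  unfold continuation
  rw [hm, hsplit, hsub, hP, hS]
  ring

theorem norm_tail_le {n a : ℕ → ℝ} (hunb : Tendsto n atTop atTop)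
    (hapos : ∀ j, 0 ≤ a j) {P : Polynomial ℝ} {θ q : ℝ}
    (hA : remainder n a P =O[atTop] fun x : ℝ => x ^ θ * Real.log x ^ q)
    {β : ℝ} (hβ : 0 < β) :
    ∃ C : ℝ, 0 ≤ C ∧ ∀ (s : ℂ) (X : ℝ), θ + β ≤ s.re → 2 ≤ X →
      ‖∫ x in Set.Ioi X, (remainder n a P x : ℂ) * (x : ℂ) ^ (-s - 1)‖ ≤
        C / (s.re - θ) * (X ^ (θ - s.re) * Real.log X ^ q) := by
  obtain ⟨C, hC0, hC⟩ := exists_remainder_bound hunb hapos hA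
  obtain ⟨K, hK0, hK⟩ := log_rpow_le q (half_pos hβ)
  refine ⟨2 * (C * K), by positivity, fun s X hs hX => ?_⟩
  have hX0 : 0 < X := by linarith
  have hlX : 0 < Real.log X := Real.log_pos (by linarith)
  have hlt : θ + β / 2 - s.re - 1 < -1 := by linarith
  have hint := integrableOn_Ioi_rpow_of_lt hlt hX0
  set D := C * K * Real.log X ^ q * X ^ (-(β / 2)) with hD
  have hD0 : 0 ≤ D := by positivity
  have hbd : ∀ᵐ x ∂volume.restrict (Set.Ioi X),
      ‖(remainder n a P x : ℂ) * (x : ℂ) ^ (-s - 1)‖ ≤ D * x ^ (θ + β / 2 - s.re - 1) := by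
    refine (ae_restrict_iff' measurableSet_Ioi).2 (Eventually.of_forall fun x hx => ?_)
    have hx : X < x := hx
    have hx0 : 0 < x := by linarith
    rw [norm_mul, Complex.norm_real, Real.norm_eq_abs,
      Complex.norm_cpow_eq_rpow_re_of_pos hx0]
    have e : (-s - 1).re = -s.re - 1 := by simp
    rw [e]
    calc |remainder n a P x| * x ^ (-s.re - 1)
        ≤ C * (x ^ θ * (K * Real.log X ^ q * (x / X) ^ (β / 2))) * x ^ (-s.re - 1) := by
          gcongr
          refine (hC x (by linarith)).trans ?_
          gcongr
          exact hK X x hX hx.le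
      _ = D * x ^ (θ + β / 2 - s.re - 1) := by
          rw [hD, Real.div_rpow hx0.le hX0.le, Real.rpow_neg hX0.le,
            show θ + β / 2 - s.re - 1 = θ + β / 2 + (-s.re - 1) by ring,
            Real.rpow_add hx0, Real.rpow_add hx0]
          ring
  refine (norm_integral_le_of_norm_le (hint.const_mul D) hbd).trans ?_
  rw [integral_const_mul, integral_Ioi_rpow_of_lt hlt hX0, sub_add_cancel]
  have e2 : D * (-X ^ (θ + β / 2 - s.re) / (θ + β / 2 - s.re)) =
      C * K * (X ^ (θ - s.re) * Real.log X ^ q) / (s.re - θ - β / 2) := by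
    rw [hD, show θ + β / 2 - s.re = (θ - s.re) + β / 2 by ring, Real.rpow_add hX0,
      Real.rpow_neg hX0.le, show θ - s.re + β / 2 = -(s.re - θ - β / 2) by ring]
    field_simp
  rw [e2, show 2 * (C * K) / (s.re - θ) * (X ^ (θ - s.re) * Real.log X ^ q) =
    C * K * (X ^ (θ - s.re) * Real.log X ^ q) / ((s.re - θ) / 2) by field_simp]
  gcongr
  · linarith
  · linarith

theorem one_add_log_pow_le (d : ℕ) :
    ∃ c : ℝ, 0 ≤ c ∧ ∀ X : ℝ, 2 ≤ X → (1 + Real.log X) ^ d ≤ c * Real.log X ^ (d : ℝ) := by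
  have hl2 : 0 < Real.log 2 := Real.log_pos one_lt_two
  refine ⟨(1 / Real.log 2 + 1) ^ d, by positivity, fun X hX => ?_⟩
  have hlX : Real.log 2 ≤ Real.log X := Real.log_le_log two_pos hX
  rw [Real.rpow_natCast, ← mul_pow]
  have h1 : 1 ≤ 1 / Real.log 2 * Real.log X := by
    rw [one_div, ← div_eq_inv_mul]
    exact (one_le_div hl2).2 hlX
  gcongr
  · linarith
  · linarith

theorem norm_continuation_sub_le {n a : ℕ → ℝ} (hunb : Tendsto n atTop atTop)
    (hn : ∀ j, 1 ≤ n j) (hapos : ∀ j, 0 ≤ a j) {P : Polynomial ℝ} {θ q : ℝ} (hθ0 : 0 ≤ θ)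
    (hθ1 : θ < 1)
    (hA : remainder n a P =O[atTop] fun x : ℝ => x ^ θ * Real.log x ^ q)
    {β : ℝ} (hβ : 0 < β) :
    ∃ C : ℝ, 0 ≤ C ∧ ∀ (s : ℂ) (X : ℝ), θ + β ≤ s.re → s ≠ 1 → 2 ≤ X →
      ‖continuation n a P s -
        ∑ j ∈ (finite_setOf_le hunb X).toFinset, (a j : ℂ) * (n j : ℂ) ^ (-s)‖ ≤
      C * (X ^ (1 - s.re) * Real.log X ^ (P.natDegree : ℝ) *
          (1 + ‖s‖ * ∑ k ∈ Finset.range (P.natDegree + 1), (1 / ‖s - 1‖) ^ (k + 1)) +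
        ‖s‖ / (s.re - θ) * (X ^ (θ - s.re) * Real.log X ^ q)) := by
  obtain ⟨B, hB0, hB⟩ := norm_polarPart_le P
  obtain ⟨C₁, hC₁0, hC₁⟩ := exists_countingFn_bound hunb hapos hθ1 hA
  obtain ⟨C₂, hC₂0, hC₂⟩ := norm_tail_le hunb hapos hA hβ
  obtain ⟨c, hc0, hc⟩ := one_add_log_pow_le P.natDegree
  refine ⟨B * c + C₁ * c + C₂, by positivity, fun s X hs hs1 hX => ?_⟩
  have hX0 : 0 < X := by linarith
  have hlX : 0 < Real.log X := Real.log_pos (by linarith)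
  have hsθ : 0 < s.re - θ := by linarith
  rw [continuation_eq hunb hn hapos hθ0 hA (by linarith) hs1 (by linarith : 1 ≤ X),
    add_sub_cancel_left]
  set S := ∑ k ∈ Finset.range (P.natDegree + 1), (1 / ‖s - 1‖) ^ (k + 1) with hS
  have hS0 : 0 ≤ S := Finset.sum_nonneg fun k _ => by positivity
  set L := Real.log X ^ (P.natDegree : ℝ) with hL
  have hL0 : 0 ≤ L := by positivity
  have h1 : ‖s * ((X : ℂ) ^ (1 - s) * polarPart P s (Real.log X))‖ ≤
      B * c * (X ^ (1 - s.re) * L * (‖s‖ * S)) := by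
    rw [norm_mul, norm_mul, Complex.norm_cpow_eq_rpow_re_of_pos hX0]
    calc ‖s‖ * (X ^ (1 - s).re * ‖polarPart P s (Real.log X)‖)
        ≤ ‖s‖ * (X ^ (1 - s.re) * (B * (c * L) * S)) := by
          have e : (1 - s).re = 1 - s.re := by simp
          rw [e]
          gcongr
          refine (hB s _ hlX.le).trans ?_
          gcongr
          exact hc X hX
      _ = _ := by ring
  have h2 : ‖(countingFn n a X : ℂ) * (X : ℂ) ^ (-s)‖ ≤ C₁ * c * (X ^ (1 - s.re) * L) := by
    rw [norm_mul, Complex.norm_real, Real.norm_of_nonneg (countingFn_nonneg hapos X),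
      Complex.norm_cpow_eq_rpow_re_of_pos hX0]
    calc countingFn n a X * X ^ (-s).re ≤ C₁ * (X * (c * L)) * X ^ (-s).re := by
          gcongr
          refine (hC₁ X (by linarith)).trans ?_
          gcongr
          exact hc X hX
      _ = _ := by
          rw [Complex.neg_re, sub_eq_add_neg, Real.rpow_add hX0, Real.rpow_one]
          ring
  have h3 : ‖s * ∫ x in Set.Ioi X, (remainder n a P x : ℂ) * (x : ℂ) ^ (-s - 1)‖ ≤
      C₂ * (‖s‖ / (s.re - θ) * (X ^ (θ - s.re) * Real.log X ^ q)) := by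
    rw [norm_mul]
    refine (mul_le_mul_of_nonneg_left (hC₂ s X hs hX) (norm_nonneg _)).trans (le_of_eq ?_)
    ring
  have hU : 0 ≤ X ^ (1 - s.re) * L := by positivity
  have hV : 0 ≤ X ^ (1 - s.re) * L * (‖s‖ * S) := by positivity
  have hW : 0 ≤ ‖s‖ / (s.re - θ) * (X ^ (θ - s.re) * Real.log X ^ q) := by positivity
  have hBc : 0 ≤ B * c := by positivity
  have hCc : 0 ≤ C₁ * c := by positivity
  refine (norm_add_le _ _).trans ((add_le_add (norm_sub_le _ _) le_rfl).trans
    ((add_le_add (add_le_add h1 h2) h3).trans ?_))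
  rw [mul_one_add]
  generalize X ^ (1 - s.re) * L = U at *
  generalize ‖s‖ / (s.re - θ) * (X ^ (θ - s.re) * Real.log X ^ q) = W at *
  generalize U * (‖s‖ * S) = V at *
  generalize B * c = b₁ at *
  generalize C₁ * c = b₂ at *
  have hr : 0 ≤ b₁ * (U + W) + b₂ * (V + W) + C₂ * (U + V) := by positivity
  linarith

theorem tendsto_partialSum {n a : ℕ → ℝ} (hunb : Tendsto n atTop atTop)
    (hn : ∀ j, 1 ≤ n j) (hapos : ∀ j, 0 ≤ a j) {P : Polynomial ℝ} {θ q : ℝ} (hθ0 : 0 ≤ θ)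
    (hθ1 : θ < 1)
    (hA : remainder n a P =O[atTop] fun x : ℝ => x ^ θ * Real.log x ^ q)
    {s : ℂ} (hs : 1 < s.re) :
    Tendsto (fun X : ℝ =>
        ∑ j ∈ (finite_setOf_le hunb X).toFinset, (a j : ℂ) * (n j : ℂ) ^ (-s))
      atTop (nhds (continuation n a P s)) := by
  obtain ⟨C, hC0, hC⟩ := norm_continuation_sub_le hunb hn hapos hθ0 hθ1 hA (sub_pos.2 hθ1)
  have hs1 : s ≠ 1 := by
    rintro rfl
    simp at hs
  have key : ∀ b r : ℝ, b < 0 →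
      Tendsto (fun X : ℝ => X ^ b * Real.log X ^ r) atTop (nhds 0) := by
    intro b r hb
    obtain ⟨K, hK0, hK⟩ := rpow_mul_log_rpow_le b r (ε := -b / 2) (by linarith)
    have h1 : Tendsto (fun X : ℝ => K * X ^ (-(-b / 2))) atTop (nhds 0) := by
      simpa using (tendsto_rpow_neg_atTop (y := -b / 2) (by linarith)).const_mul K
    refine squeeze_zero' ?_ ?_ h1
    · filter_upwards [eventually_ge_atTop 2] with X hX
      have : 0 ≤ Real.log X := Real.log_nonneg (by linarith)
      positivity
    · filter_upwards [eventually_ge_atTop 2] with X hX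
      refine (hK X hX).trans (le_of_eq ?_)
      congr 2
      ring
  rw [tendsto_iff_norm_sub_tendsto_zero]
  have h1 := (((key (1 - s.re) P.natDegree (by linarith)).mul_const
      (1 + ‖s‖ * ∑ k ∈ Finset.range (P.natDegree + 1), (1 / ‖s - 1‖) ^ (k + 1))).add
    ((key (θ - s.re) q (by linarith)).const_mul (‖s‖ / (s.re - θ)))).const_mul C
  simp only [zero_mul, mul_zero, add_zero] at h1
  refine squeeze_zero' (Eventually.of_forall fun X => norm_nonneg _) ?_ h1
  filter_upwards [eventually_ge_atTop 2] with X hX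
  rw [norm_sub_rev]
  exact hC s X (by linarith) hs1 hX

theorem ofReal_sum_rpow {n a : ℕ → ℝ} (hn : ∀ j, 1 ≤ n j) (T : Finset ℕ) (σ : ℝ) :
    ((∑ j ∈ T, a j * n j ^ (-σ) : ℝ) : ℂ) = ∑ j ∈ T, (a j : ℂ) * (n j : ℂ) ^ (-(σ : ℂ)) := by
  push_cast
  refine Finset.sum_congr rfl fun j _ => ?_
  rw [Complex.ofReal_cpow (by linarith [hn j])]
  simp

theorem norm_mul_cpow {n a : ℕ → ℝ} (hn : ∀ j, 1 ≤ n j) (hapos : ∀ j, 0 ≤ a j) (s : ℂ) (j : ℕ) :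
    ‖(a j : ℂ) * (n j : ℂ) ^ (-s)‖ = a j * n j ^ (-s.re) := by
  rw [norm_mul, Complex.norm_real, Real.norm_of_nonneg (hapos j),
    Complex.norm_cpow_eq_rpow_re_of_pos (by linarith [hn j]), Complex.neg_re]

theorem tendsto_toFinset_setOf_le {n : ℕ → ℝ} (hunb : Tendsto n atTop atTop) :
    Tendsto (fun X : ℝ => (finite_setOf_le hunb X).toFinset) atTop atTop := by
  refine tendsto_atTop_finset_of_monotone (fun X Y hXY j hj => ?_) fun j => ⟨n j, by simp⟩
  simp only [Set.Finite.mem_toFinset, Set.mem_ofPred_eq] at hj ⊢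
  exact hj.trans hXY

theorem continuation_eq_tsum {n a : ℕ → ℝ} (hunb : Tendsto n atTop atTop)
    (hn : ∀ j, 1 ≤ n j) (hapos : ∀ j, 0 ≤ a j) {P : Polynomial ℝ} {θ q : ℝ} (hθ0 : 0 ≤ θ)
    (hθ1 : θ < 1)
    (hA : remainder n a P =O[atTop] fun x : ℝ => x ^ θ * Real.log x ^ q)
    {s : ℂ} (hs : 1 < s.re) :
    continuation n a P s = ∑' j : ℕ, (a j : ℂ) * (n j : ℂ) ^ (-s) := by
  have hpos : ∀ j, 0 ≤ a j * n j ^ (-s.re) := fun j =>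
    mul_nonneg (hapos j) (Real.rpow_nonneg (by linarith [hn j]) _)
  have hT := tendsto_toFinset_setOf_le hunb
  have hsum : Summable fun j => a j * n j ^ (-s.re) := by
    have h1 := (tendsto_partialSum hunb hn hapos hθ0 hθ1 hA (s := (s.re : ℂ))
      (by simpa using hs)).norm
    set M := ‖continuation n a P (s.re : ℂ)‖ + 1
    have h2 := h1.eventually (gt_mem_nhds (lt_add_one _))
    refine summable_of_sum_le hpos (c := M) fun u => ?_
    obtain ⟨X, hX1, hX2⟩ := (h2.and (hT.eventually (eventually_ge_atTop u))).exists
    rw [← ofReal_sum_rpow hn, Complex.norm_real] at hX1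
    exact (Finset.sum_le_sum_of_subset_of_nonneg hX2 fun j _ _ => hpos j).trans
      ((le_abs_self _).trans hX1.le)
  have hsumC : Summable fun j => (a j : ℂ) * (n j : ℂ) ^ (-s) := by
    refine Summable.of_norm ?_
    simpa only [norm_mul_cpow hn hapos] using hsum
  exact tendsto_nhds_unique (tendsto_partialSum hunb hn hapos hθ0 hθ1 hA hs)
    (hsumC.hasSum.comp hT)

theorem sum_rpow_le {n a : ℕ → ℝ} (hunb : Tendsto n atTop atTop)
    (hn : ∀ j, 1 ≤ n j) (hapos : ∀ j, 0 ≤ a j) {P : Polynomial ℝ} {θ q : ℝ}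
    (hθ1 : θ < 1)
    (hA : remainder n a P =O[atTop] fun x : ℝ => x ^ θ * Real.log x ^ q) :
    ∃ C : ℝ, 0 ≤ C ∧ ∀ σ X : ℝ, 0 < σ → 1 ≤ X →
      ∑ j ∈ (finite_setOf_le hunb X).toFinset, a j * n j ^ (-σ) ≤
        C * (1 + Real.log X) ^ P.natDegree *
          (X ^ (1 - σ) + σ * ∫ x in (1 : ℝ)..X, x ^ (-σ)) := by
  obtain ⟨C, hC0, hC⟩ := exists_countingFn_bound hunb hapos hθ1 hA
  refine ⟨C, hC0, fun σ X hσ hX => ?_⟩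
  have hX0 : 0 < X := by linarith
  have hlX := Real.log_nonneg hX
  have h := congrArg norm (partial_summation (a := a) hunb hn hX
    (s := (σ : ℂ)) (by exact_mod_cast hσ.ne')).2
  rw [← ofReal_sum_rpow hn, Complex.norm_real] at h
  refine (le_abs_self _).trans (h.le.trans ((norm_add_le _ _).trans ?_))
  set D := C * (1 + Real.log X) ^ P.natDegree with hD
  have hb : ∀ x, 1 ≤ x → x ≤ X → countingFn n a x ≤ D * x := by
    intro x h1 hx
    refine (hC x h1).trans ?_
    have hlx := Real.log_nonneg h1
    have : Real.log x ≤ Real.log X := Real.log_le_log (by linarith) hx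
    calc C * (x * (1 + Real.log x) ^ P.natDegree)
        ≤ C * (x * (1 + Real.log X) ^ P.natDegree) := by gcongr
      _ = _ := by rw [hD]; ring
  have h1 : ‖(countingFn n a X : ℂ) * (X : ℂ) ^ (-(σ : ℂ))‖ ≤ D * X ^ (1 - σ) := by
    rw [norm_mul, Complex.norm_real, Real.norm_of_nonneg (countingFn_nonneg hapos X),
      Complex.norm_cpow_eq_rpow_re_of_pos hX0, Complex.neg_re, Complex.ofReal_re]
    refine (mul_le_mul_of_nonneg_right (hb X hX le_rfl) (by positivity)).trans (le_of_eq ?_)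
    rw [sub_eq_add_neg, Real.rpow_add hX0, Real.rpow_one]
    ring
  have h2 : ‖∫ x in (1 : ℝ)..X, (countingFn n a x : ℂ) * (x : ℂ) ^ (-(σ : ℂ) - 1)‖ ≤
      ∫ x in (1 : ℝ)..X, D * x ^ (-σ) := by
    refine intervalIntegral.norm_integral_le_of_norm_le hX
      (Eventually.of_forall fun x hx => ?_) ?_
    · have hx0 : 0 < x := by linarith [hx.1]
      rw [norm_mul, Complex.norm_real, Real.norm_of_nonneg (countingFn_nonneg hapos x),
        Complex.norm_cpow_eq_rpow_re_of_pos hx0]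
      have e : (-(σ : ℂ) - 1).re = -σ - 1 := by simp
      rw [e]
      refine (mul_le_mul_of_nonneg_right (hb x hx.1.le hx.2) (by positivity)).trans (le_of_eq ?_)
      rw [Real.rpow_sub_one hx0.ne']
      field_simp
    · refine (intervalIntegral.intervalIntegrable_rpow (Or.inr fun h => ?_)).const_mul D
      rcases Set.mem_uIcc.1 h with h | h <;> linarith
  rw [norm_mul (σ : ℂ), Complex.norm_real, Real.norm_of_nonneg hσ.le]
  rw [intervalIntegral.integral_const_mul] at h2
  calc _ ≤ D * X ^ (1 - σ) + σ * (D * ∫ x in (1 : ℝ)..X, x ^ (-σ)) := by gcongr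
    _ = _ := by ring

theorem log_rpow_le_log_rpow {r m : ℝ} (hrm : r ≤ m) {x : ℝ} (hx : 2 ≤ x) :
    Real.log x ^ r ≤ Real.log 2 ^ (r - m) * Real.log x ^ m := by
  have hl2 : 0 < Real.log 2 := Real.log_pos one_lt_two
  have hlx : Real.log 2 ≤ Real.log x := Real.log_le_log two_pos hx
  have h := Real.rpow_le_rpow_of_nonpos hl2 hlx (sub_nonpos.2 hrm)
  calc Real.log x ^ r = Real.log x ^ (r - m) * Real.log x ^ m := by
        rw [← Real.rpow_add (hl2.trans_le hlx), sub_add_cancel]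
    _ ≤ _ := mul_le_mul_of_nonneg_right h (Real.rpow_nonneg (hl2.le.trans hlx) _)

theorem norm_continuation_sub_le_of_rpow_eq {n a : ℕ → ℝ} (hunb : Tendsto n atTop atTop)
    (hn : ∀ j, 1 ≤ n j) (hapos : ∀ j, 0 ≤ a j) {P : Polynomial ℝ} {θ q : ℝ} (hθ0 : 0 ≤ θ)
    (hθ1 : θ < 1)
    (hA : remainder n a P =O[atTop] fun x : ℝ => x ^ θ * Real.log x ^ q)
    {β : ℝ} (hβ : 0 < β) :
    ∃ C : ℝ, 0 ≤ C ∧ ∀ (s : ℂ) (X : ℝ), θ + β ≤ s.re → 2 ≤ |s.im| → 2 ≤ X →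
      X ^ (1 - θ) = |s.im| →
      ‖continuation n a P s -
        ∑ j ∈ (finite_setOf_le hunb X).toFinset, (a j : ℂ) * (n j : ℂ) ^ (-s)‖ ≤
      C * X ^ (1 - s.re) * (Real.log X ^ (P.natDegree : ℝ) + Real.log X ^ q) := by
  obtain ⟨C, hC0, hC⟩ := norm_continuation_sub_le hunb hn hapos hθ0 hθ1 hA hβ
  refine ⟨C * max (1 + 2 * ((P.natDegree : ℝ) + 1)) (1 + 2 / β), by positivity,
    fun s X hs ht hX hXt => ?_⟩
  have hX0 : 0 < X := by linarith
  have hlX : 0 < Real.log X := Real.log_pos (by linarith)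
  have hs1 : s ≠ 1 := by
    rintro rfl
    norm_num at ht
  refine (hC s X hs hs1 hX).trans ?_
  have him : |s.im| ≤ ‖s - 1‖ := by simpa using Complex.abs_im_le_norm (s - 1)
  have hs2 : 2 ≤ ‖s - 1‖ := ht.trans him
  have hnorm : ‖s‖ ≤ 2 * ‖s - 1‖ := by
    have := norm_add_le (s - 1) 1
    rw [sub_add_cancel, norm_one] at this
    linarith
  have hsum : ‖s‖ * ∑ k ∈ Finset.range (P.natDegree + 1), (1 / ‖s - 1‖) ^ (k + 1) ≤
      2 * (P.natDegree + 1) := by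
    have h1 : ∀ k ∈ Finset.range (P.natDegree + 1),
        (1 / ‖s - 1‖) ^ (k + 1) ≤ 1 / ‖s - 1‖ := fun k _ =>
      pow_le_of_le_one (by positivity) ((div_le_one (by linarith)).2 (by linarith)) k.succ_ne_zero
    have h2 := Finset.sum_le_card_nsmul _ _ _ h1
    rw [Finset.card_range, nsmul_eq_mul] at h2
    calc _ ≤ 2 * ‖s - 1‖ * (((P.natDegree + 1 : ℕ) : ℝ) * (1 / ‖s - 1‖)) := by gcongr
      _ = _ := by
        push_cast
        field_simp
  have hσ : 0 < s.re - θ := by linarith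
  have hdiv : ‖s‖ / (s.re - θ) ≤ (1 + 2 / β) * |s.im| := by
    have h1 := Complex.norm_le_abs_re_add_abs_im s
    rw [abs_of_pos (by linarith : 0 < s.re)] at h1
    have h2 : |s.im| / (s.re - θ) ≤ |s.im| / β := by
      gcongr
      linarith
    calc ‖s‖ / (s.re - θ) ≤ ((s.re - θ) + 2 * |s.im|) / (s.re - θ) := by
          gcongr
          linarith
      _ = 1 + 2 * (|s.im| / (s.re - θ)) := by field_simp
      _ ≤ |s.im| + 2 * (|s.im| / β) := by linarith
      _ = _ := by ring
  have hpow : |s.im| * X ^ (θ - s.re) = X ^ (1 - s.re) := by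
    rw [← hXt, ← Real.rpow_add hX0]
    congr 1
    ring
  set M := max (1 + 2 * ((P.natDegree : ℝ) + 1)) (1 + 2 / β)
  have hM1 : 1 + 2 * ((P.natDegree : ℝ) + 1) ≤ M := le_max_left _ _
  have hM2 : 1 + 2 / β ≤ M := le_max_right _ _
  calc _ ≤ C * (X ^ (1 - s.re) * Real.log X ^ (P.natDegree : ℝ) * M +
        M * |s.im| * (X ^ (θ - s.re) * Real.log X ^ q)) := by
        gcongr
        · linarith
        · exact hdiv.trans (by gcongr)
    _ = C * (X ^ (1 - s.re) * Real.log X ^ (P.natDegree : ℝ) * M +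
        M * (|s.im| * X ^ (θ - s.re)) * Real.log X ^ q) := by ring
    _ = _ := by rw [hpow]; ring

theorem norm_sum_mul_cpow_le {n a : ℕ → ℝ} (hn : ∀ j, 1 ≤ n j) (hapos : ∀ j, 0 ≤ a j)
    (T : Finset ℕ) (s : ℂ) :
    ‖∑ j ∈ T, (a j : ℂ) * (n j : ℂ) ^ (-s)‖ ≤ ∑ j ∈ T, a j * n j ^ (-s.re) :=
  (norm_sum_le _ _).trans (Finset.sum_le_sum fun j _ => (norm_mul_cpow hn hapos s j).le)

theorem sum_rpow_le_of_lt_one {n a : ℕ → ℝ} (hunb : Tendsto n atTop atTop)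
    (hn : ∀ j, 1 ≤ n j) (hapos : ∀ j, 0 ≤ a j) {P : Polynomial ℝ} {θ q : ℝ}
    (hθ1 : θ < 1)
    (hA : remainder n a P =O[atTop] fun x : ℝ => x ^ θ * Real.log x ^ q)
    {δ : ℝ} (hδ : 0 < δ) :
    ∃ C : ℝ, 0 ≤ C ∧ ∀ σ X : ℝ, 0 < σ → σ ≤ 1 - δ → 2 ≤ X →
      ∑ j ∈ (finite_setOf_le hunb X).toFinset, a j * n j ^ (-σ) ≤
        C * X ^ (1 - σ) * Real.log X ^ (P.natDegree : ℝ) := by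
  obtain ⟨C, hC0, hC⟩ := sum_rpow_le hunb hn hapos hθ1 hA
  obtain ⟨c, hc0, hc⟩ := one_add_log_pow_le P.natDegree
  refine ⟨C * c * (1 + 1 / δ), by positivity, fun σ X hσ hσ1 hX => ?_⟩
  have hX0 : 0 < X := by linarith
  have hlX : 0 < Real.log X := Real.log_pos (by linarith)
  have hint : σ * ∫ x in (1 : ℝ)..X, x ^ (-σ) ≤ X ^ (1 - σ) * (1 / δ) := by
    rw [integral_rpow (Or.inl (by linarith)), neg_add_eq_sub, Real.one_rpow]
    have h1 : (X ^ (1 - σ) - 1) / (1 - σ) ≤ X ^ (1 - σ) / δ := by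
      have : 0 < X ^ (1 - σ) := by positivity
      gcongr
      · linarith
      · linarith
    have h2 : 0 ≤ X ^ (1 - σ) / δ := by positivity
    calc σ * ((X ^ (1 - σ) - 1) / (1 - σ)) ≤ σ * (X ^ (1 - σ) / δ) := by gcongr
      _ ≤ 1 * (X ^ (1 - σ) / δ) := by
          gcongr
          linarith
      _ = _ := by ring
  calc _ ≤ C * (1 + Real.log X) ^ P.natDegree *
          (X ^ (1 - σ) + σ * ∫ x in (1 : ℝ)..X, x ^ (-σ)) := hC σ X hσ (by linarith)
    _ ≤ C * (1 + Real.log X) ^ P.natDegree * (X ^ (1 - σ) + X ^ (1 - σ) * (1 / δ)) := by gcongr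
    _ ≤ C * (c * Real.log X ^ (P.natDegree : ℝ)) * (X ^ (1 - σ) + X ^ (1 - σ) * (1 / δ)) := by
        gcongr
        exact hc X hX
    _ = _ := by ring

theorem sum_div_le {n a : ℕ → ℝ} (hunb : Tendsto n atTop atTop)
    (hn : ∀ j, 1 ≤ n j) (hapos : ∀ j, 0 ≤ a j) {P : Polynomial ℝ} {θ q : ℝ}
    (hθ1 : θ < 1)
    (hA : remainder n a P =O[atTop] fun x : ℝ => x ^ θ * Real.log x ^ q) :
    ∃ C : ℝ, 0 ≤ C ∧ ∀ X : ℝ, 2 ≤ X →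
      ∑ j ∈ (finite_setOf_le hunb X).toFinset, a j * n j ^ (-1 : ℝ) ≤
        C * Real.log X ^ ((P.natDegree : ℝ) + 1) := by
  obtain ⟨C, hC0, hC⟩ := sum_rpow_le hunb hn hapos hθ1 hA
  obtain ⟨c, hc0, hc⟩ := one_add_log_pow_le (P.natDegree + 1)
  refine ⟨C * c, by positivity, fun X hX => ?_⟩
  have hX0 : 0 < X := by linarith
  refine (hC 1 X one_pos (by linarith)).trans (le_of_eq_of_le ?_
    ((mul_le_mul_of_nonneg_left (hc X hX) hC0).trans_eq ?_))
  · simp only [Real.rpow_neg_one]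
    rw [integral_inv_of_pos one_pos hX0]
    simp
    ring
  · push_cast
    ring

theorem sum_rpow_le_rpow_mul_sum_div {n a : ℕ → ℝ} (hn : ∀ j, 1 ≤ n j) (hapos : ∀ j, 0 ≤ a j)
    {T : Finset ℕ} {X : ℝ} (hT : ∀ j ∈ T, n j ≤ X) (σ : ℝ) :
    ∑ j ∈ T, a j * n j ^ (-σ) ≤ (X ^ (1 - σ) + 1) * ∑ j ∈ T, a j * n j ^ (-1 : ℝ) := by
  rw [Finset.mul_sum]
  refine Finset.sum_le_sum fun j hj => ?_
  have hj1 := hn j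
  have hj0 : 0 < n j := by linarith
  have hX0 : 0 < X := hj0.trans_le (hT j hj)
  have h1 : n j ^ (1 - σ) ≤ X ^ (1 - σ) + 1 := by
    rcases le_or_gt σ 1 with h | h
    · have := Real.rpow_le_rpow hj0.le (hT j hj) (sub_nonneg.2 h)
      linarith
    · have := Real.rpow_le_one_of_one_le_of_nonpos hj1 (by linarith : 1 - σ ≤ 0)
      have : 0 < X ^ (1 - σ) := by positivity
      linarith
  have := hapos j
  calc a j * n j ^ (-σ) = n j ^ (1 - σ) * (a j * n j ^ (-1 : ℝ)) := by
        rw [show -σ = (1 - σ) + -1 by ring, Real.rpow_add hj0]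
        ring
    _ ≤ _ := by gcongr

theorem two_le_rpow_inv {θ τ : ℝ} (hθ0 : 0 ≤ θ) (hθ1 : θ < 1) (hτ : 2 ≤ τ) :
    2 ≤ τ ^ (1 / (1 - θ)) := by
  refine hτ.trans (Real.self_le_rpow_of_one_le (by linarith) ?_)
  rw [le_div_iff₀ (by linarith)]
  linarith

theorem log_rpow_inv_rpow {θ τ : ℝ} (hθ1 : θ < 1) (hτ : 2 ≤ τ) (r : ℝ) :
    Real.log (τ ^ (1 / (1 - θ))) ^ r = (1 / (1 - θ)) ^ r * Real.log τ ^ r := by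
  have h1 : 0 < 1 - θ := by linarith
  rw [Real.log_rpow (by linarith), Real.mul_rpow (by positivity)
    (Real.log_nonneg (by linarith))]

theorem exists_log_rpow_inv_rpow_le {θ r m : ℝ} (hθ1 : θ < 1) (hrm : r ≤ m) :
    ∃ K : ℝ, 0 ≤ K ∧ ∀ τ : ℝ, 2 ≤ τ →
      Real.log (τ ^ (1 / (1 - θ))) ^ r ≤ K * Real.log τ ^ m := by
  have h1 : 0 < 1 - θ := by linarith
  have hl2 : 0 < Real.log 2 := Real.log_pos one_lt_two
  refine ⟨(1 / (1 - θ)) ^ r * Real.log 2 ^ (r - m), by positivity, fun τ hτ => ?_⟩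
  rw [log_rpow_inv_rpow hθ1 hτ, mul_assoc]
  exact mul_le_mul_of_nonneg_left (log_rpow_le_log_rpow hrm hτ) (by positivity)

/-- Lemma 4.2: polynomial (convexity-type) bounds for a general Dirichlet series with
non-negative coefficients whose counting function satisfies
`A(x) = x·P(log x) + O(x^θ (log x)^q)`. -/
theorem pointwise_polynomial_bounds
    (θ : ℝ) (hθ0 : 0 ≤ θ) (hθ1 : θ < 1)
    (n : ℕ → ℝ) (hn0 : n 0 = 1) (hmono : Monotone n)
    (hunb : Tendsto n atTop atTop)
    (a : ℕ → ℝ) (hapos : ∀ j, 0 ≤ a j)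
    (P : Polynomial ℝ) (d : ℕ) (hPd : P.degree = d) (q : ℝ)
    (hA : (fun x : ℝ =>
        (∑' j : ℕ, Set.indicator {j : ℕ | n j ≤ x} a j) - x * P.eval (Real.log x))
      =O[atTop] fun x : ℝ => x ^ θ * Real.log x ^ q) :
    ∃ FZ : ℂ → ℂ,
      (∀ s : ℂ, 1 < s.re → FZ s = ∑' j : ℕ, (a j : ℂ) * (n j : ℂ) ^ (-s)) ∧
      DifferentiableOn ℂ FZ {s : ℂ | θ < s.re ∧ s ≠ 1} ∧
      (∀ δ > (0:ℝ), ∃ C : ℝ, ∀ σ t : ℝ, θ + δ ≤ σ → σ ≤ 1 - δ → 2 ≤ |t| →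
        ‖FZ ((σ : ℂ) + Complex.I * (t : ℂ))‖ ≤
          C * |t| ^ ((1 - σ) / (1 - θ)) * Real.log |t| ^ (max (d : ℝ) q)) ∧
      (∃ C : ℝ, ∀ σ t : ℝ, (1 + θ) / 2 ≤ σ → 2 ≤ |t| →
        ‖FZ ((σ : ℂ) + Complex.I * (t : ℂ))‖ ≤
          C * (|t| ^ ((1 - σ) / (1 - θ)) * Real.log |t| ^ (max ((d : ℝ) + 1) q)
            + Real.log |t| ^ ((d : ℝ) + 1))) := by
  have hn : ∀ j, 1 ≤ n j := fun j => hn0.symm.le.trans (hmono (Nat.zero_le j))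
  have hA' : remainder n a P =O[atTop] fun x : ℝ => x ^ θ * Real.log x ^ q := hA
  obtain rfl : P.natDegree = d := Polynomial.natDegree_eq_of_degree_eq_some hPd
  have hθ : 0 < 1 - θ := by linarith
  have hre : ∀ σ t : ℝ, ((σ : ℂ) + Complex.I * (t : ℂ)).re = σ := fun σ t => by simp
  have him : ∀ σ t : ℝ, ((σ : ℂ) + Complex.I * (t : ℂ)).im = t := fun σ t => by simp
  have hXpow : ∀ τ : ℝ, 2 ≤ τ → (τ ^ (1 / (1 - θ))) ^ (1 - θ) = τ := fun τ hτ => by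
    rw [← Real.rpow_mul (by linarith), one_div_mul_cancel hθ.ne', Real.rpow_one]
  have hXpow' : ∀ τ σ : ℝ, 2 ≤ τ →
      (τ ^ (1 / (1 - θ))) ^ (1 - σ) = τ ^ ((1 - σ) / (1 - θ)) := fun τ σ hτ => by
    rw [← Real.rpow_mul (by linarith), one_div_mul_eq_div]
  refine ⟨continuation n a P, fun s hs => continuation_eq_tsum hunb hn hapos hθ0 hθ1 hA' hs,
    continuation_differentiableOn hunb hapos hA', fun δ hδ => ?_, ?_⟩
  · obtain ⟨C₁, hC₁0, hC₁⟩ :=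
      norm_continuation_sub_le_of_rpow_eq hunb hn hapos hθ0 hθ1 hA' hδ
    obtain ⟨C₂, hC₂0, hC₂⟩ := sum_rpow_le_of_lt_one hunb hn hapos hθ1 hA' hδ
    obtain ⟨K₁, hK₁0, hK₁⟩ :=
      exists_log_rpow_inv_rpow_le hθ1 (le_max_left (P.natDegree : ℝ) q)
    obtain ⟨K₂, hK₂0, hK₂⟩ :=
      exists_log_rpow_inv_rpow_le hθ1 (le_max_right (P.natDegree : ℝ) q)
    refine ⟨C₁ * (K₁ + K₂) + C₂ * K₁, fun σ t hσ hσ1 ht => ?_⟩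
    have hX := two_le_rpow_inv hθ0 hθ1 ht
    have h1 := hC₁ (σ + Complex.I * t) _ (by rwa [hre]) (by rwa [him]) hX
      (by rw [him]; exact hXpow _ ht)
    have h2 := norm_sum_mul_cpow_le hn hapos
      (finite_setOf_le hunb (|t| ^ (1 / (1 - θ)))).toFinset (σ + Complex.I * t)
    have h3 := hC₂ σ _ (by linarith) hσ1 hX
    rw [hre] at h1 h2
    rw [hXpow' _ _ ht] at h1 h3
    have hk₁ := hK₁ _ ht
    have hk₂ := hK₂ _ ht
    have h4 := norm_le_norm_sub_add (continuation n a P (σ + Complex.I * t))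
      (∑ j ∈ (finite_setOf_le hunb (|t| ^ (1 / (1 - θ)))).toFinset,
        (a j : ℂ) * (n j : ℂ) ^ (-(σ + Complex.I * t)))
    have hY : 0 ≤ |t| ^ ((1 - σ) / (1 - θ)) := by positivity
    refine (h4.trans (add_le_add h1 (h2.trans h3))).trans ?_
    set L := Real.log |t| ^ max (P.natDegree : ℝ) q
    calc _ ≤ C₁ * |t| ^ ((1 - σ) / (1 - θ)) * (K₁ * L + K₂ * L) +
          C₂ * |t| ^ ((1 - σ) / (1 - θ)) * (K₁ * L) := by gcongr
      _ = _ := by ring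
  · obtain ⟨C₁, hC₁0, hC₁⟩ :=
      norm_continuation_sub_le_of_rpow_eq hunb hn hapos hθ0 hθ1 hA' (half_pos hθ)
    obtain ⟨C₂, hC₂0, hC₂⟩ := sum_div_le hunb hn hapos hθ1 hA'
    obtain ⟨K₁, hK₁0, hK₁⟩ := exists_log_rpow_inv_rpow_le hθ1
      ((le_add_of_nonneg_right zero_le_one).trans (le_max_left ((P.natDegree : ℝ) + 1) q))
    obtain ⟨K₂, hK₂0, hK₂⟩ :=
      exists_log_rpow_inv_rpow_le hθ1 (le_max_right ((P.natDegree : ℝ) + 1) q)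
    obtain ⟨K₃, hK₃0, hK₃⟩ :=
      exists_log_rpow_inv_rpow_le hθ1 (le_max_left ((P.natDegree : ℝ) + 1) q)
    obtain ⟨K₄, hK₄0, hK₄⟩ :=
      exists_log_rpow_inv_rpow_le hθ1 (le_refl ((P.natDegree : ℝ) + 1))
    refine ⟨C₁ * (K₁ + K₂) + C₂ * K₃ + C₂ * K₄, fun σ t hσ ht => ?_⟩
    have hX := two_le_rpow_inv hθ0 hθ1 ht
    have h1 := hC₁ (σ + Complex.I * t) _ (by rw [hre]; linarith) (by rwa [him]) hX
      (by rw [him]; exact hXpow _ ht)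
    have h2 := norm_sum_mul_cpow_le hn hapos
      (finite_setOf_le hunb (|t| ^ (1 / (1 - θ)))).toFinset (σ + Complex.I * t)
    have h3 := sum_rpow_le_rpow_mul_sum_div hn hapos
      (T := (finite_setOf_le hunb (|t| ^ (1 / (1 - θ)))).toFinset) (X := |t| ^ (1 / (1 - θ)))
      (fun j hj => by simpa using hj) σ
    have h5 := hC₂ _ hX
    rw [hre] at h1 h2
    rw [hXpow' _ _ ht] at h1 h3
    have hk₁ := hK₁ _ ht
    have hk₂ := hK₂ _ ht
    have hk₃ := hK₃ _ ht
    have hk₄ := hK₄ _ ht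
    have h4 := norm_le_norm_sub_add (continuation n a P (σ + Complex.I * t))
      (∑ j ∈ (finite_setOf_le hunb (|t| ^ (1 / (1 - θ)))).toFinset,
        (a j : ℂ) * (n j : ℂ) ^ (-(σ + Complex.I * t)))
    have hY : 0 ≤ |t| ^ ((1 - σ) / (1 - θ)) := by positivity
    have hlt : 0 ≤ Real.log |t| := Real.log_nonneg (by linarith)
    refine (h4.trans (add_le_add h1 (h2.trans (h3.trans
      (mul_le_mul_of_nonneg_left h5 (by linarith)))))).trans ?_
    set Y := |t| ^ ((1 - σ) / (1 - θ))
    set L := Real.log |t| ^ max ((P.natDegree : ℝ) + 1) q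
    set M := Real.log |t| ^ ((P.natDegree : ℝ) + 1)
    have hL : 0 ≤ L := by positivity
    have hM : 0 ≤ M := by positivity
    set Z := Real.log (|t| ^ (1 / (1 - θ))) ^ ((P.natDegree : ℝ) + 1)
    calc _ ≤ C₁ * Y * (K₁ * L + K₂ * L) + (Y * (C₂ * Z) + C₂ * Z) := by
          rw [add_one_mul Y]
          gcongr
      _ ≤ C₁ * Y * (K₁ * L + K₂ * L) + (Y * (C₂ * (K₃ * L)) + C₂ * (K₄ * M)) := by gcongr
      _ ≤ _ := by
          have hr : 0 ≤ (C₁ * (K₁ + K₂) + C₂ * K₃) * M + C₂ * K₄ * (Y * L) := by positivity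
          linarith
end

section
/- Let (𝒫, 𝒩) be a Beurling generalized number system whose integers are θ-well-behaved for some θ ∈ [0,1), and suppose |ζ_𝒫((1+θ)/2 + it)| ≪_B (1+|t|)^B for some 0 < B ≤ 1/2. Let T ≥ 2, N ≥ 2, let t_1, …, t_R ∈ [0, T] be 1-well-spaced points (|t_r − t_s| ≥ 1 for r ≠ s), let a_j be complex numbers, and set S(it) = ∑_{N < n_j ≤ 2N} a_j n_j^{−it}. Then ∑_{r=1}^R |S(it_r)|² ≪_B (N + N^{(1+θ)/2} T^B R) ∑_{N < n_j ≤ 2N} |a_j|². -/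
open Filter Asymptotics

/-- A Beurling generalized number system: a nondecreasing sequence of generalized
primes `p` with `1 < p 0` tending to infinity, together with the nondecreasing
enumeration `n` (with multiplicity) of all finite products of the generalized primes,
witnessed by the bijection `equiv` from exponent vectors to indices. -/
structure BeurlingSystem where
  p : ℕ → ℝ
  n : ℕ → ℝ
  one_lt_p : 1 < p 0
  mono_p : Monotone p
  tendsto_p : Tendsto p atTop atTop
  mono_n : Monotone n
  equiv : (ℕ →₀ ℕ) ≃ ℕ
  n_eq : ∀ k : ℕ →₀ ℕ, n (equiv k) = ∏ j ∈ k.support, p j ^ k j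

/-- The integer counting function `N_𝒫(x)`. -/
noncomputable def BeurlingSystem.Nint (S : BeurlingSystem) (x : ℝ) : ℕ :=
  {j : ℕ | S.n j ≤ x}.ncard

/-- `Z` is an analytic continuation of the Beurling zeta function of the system `S`
to the half-plane `Re s > θ`, with density `A`: it agrees with the Dirichlet series
on `Re s > 1` and `Z s - A/(s-1)` is analytic on `Re s > θ`. -/
def BeurlingSystem.IsZeta (S : BeurlingSystem) (θ A : ℝ) (Z : ℂ → ℂ) : Prop :=
  (∀ s : ℂ, 1 < s.re → Z s = ∑' j : ℕ, (S.n j : ℂ) ^ (-s)) ∧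
    DifferentiableOn ℂ (fun s => Z s - (A : ℂ) / (s - 1)) {s : ℂ | θ < s.re}

/-- The number of zeros (without multiplicity) of `Z` with `α ≤ Re ρ` and `|Im ρ| ≤ T`. -/
noncomputable def zeroCount (Z : ℂ → ℂ) (α T : ℝ) : ℕ :=
  {ρ : ℂ | Z ρ = 0 ∧ α ≤ ρ.re ∧ |ρ.im| ≤ T}.ncard

open Complex MeasureTheory Set Topology

/-- The Mellin transform only depends on the values on `(0, ∞)`. -/
lemma HasMellin.congr_Ioi {f g : ℝ → ℂ} {s m : ℂ} (hf : HasMellin f s m)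
    (h : ∀ x : ℝ, 0 < x → g x = f x) : HasMellin g s m := by
  have h' : EqOn (fun t : ℝ => (t : ℂ) ^ (s - 1) • f t) (fun t : ℝ => (t : ℂ) ^ (s - 1) • g t)
      (Ioi 0) := fun x hx => by simp only [h x hx]
  refine ⟨hf.1.congr_fun h' measurableSet_Ioi, ?_⟩
  rw [← hf.2]
  exact (setIntegral_congr_fun measurableSet_Ioi h').symm

lemma hasMellin_one_sub_max {s : ℂ} (hs : 0 < s.re) :
    HasMellin (fun x : ℝ => ((max (1 - x) 0 : ℝ) : ℂ)) s (1 / (s * (s + 1))) := by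
  have h0 := hasMellin_one_Ioc hs
  have h1 := hasMellin_cpow_Ioc 1 (s := s) (by simp; linarith)
  have hs0 : s ≠ 0 := fun h => by simp [h] at hs
  have hs1 : s + 1 ≠ 0 := fun h => by
    have := congrArg re h
    simp at this
    linarith
  have h2 := hasMellin_sub h0.1 h1.1
  rw [h0.2, h1.2] at h2
  have h3 : 1 / s - 1 / (s + 1) = 1 / (s * (s + 1)) := by
    field_simp
    ring
  rw [h3] at h2
  refine h2.congr_Ioi fun x hx => ?_
  by_cases hx1 : x ≤ 1
  · have : x ∈ Ioc (0 : ℝ) 1 := ⟨hx, hx1⟩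
    simp [this, max_eq_left (sub_nonneg.2 hx1)]
  · have : x ∉ Ioc (0 : ℝ) 1 := fun h => hx1 h.2
    simp [this, max_eq_right (sub_nonpos.2 (not_le.1 hx1).le)]

lemma hasMellin_one_sub_mul_max {a : ℝ} (ha : 0 < a) {s : ℂ} (hs : 0 < s.re) :
    HasMellin (fun x : ℝ => ((max (1 - a * x) 0 : ℝ) : ℂ)) s
      ((a : ℂ) ^ (-s) * (1 / (s * (s + 1)))) := by
  have h := hasMellin_one_sub_max hs
  refine ⟨(MellinConvergent.comp_mul_left ha).2 h.1, ?_⟩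
  have := mellin_comp_mul_left (fun x : ℝ => ((max (1 - x) 0 : ℝ) : ℂ)) s ha
  rw [h.2, smul_eq_mul] at this
  exact this

/-- The Fejér-type sum `∑ n_j^{-iu} (1 - n_j x)₊`. -/
noncomputable def fejerSum (n : ℕ → ℝ) (u x : ℝ) : ℂ :=
  ∑' j, (n j : ℂ) ^ (-(I * (u : ℂ))) * ((max (1 - n j * x) 0 : ℝ) : ℂ)

lemma fejerSum_eq_sum {n : ℕ → ℝ} (u : ℝ) {x : ℝ} {s : Finset ℕ}
    (h : ∀ j ∉ s, 1 ≤ n j * x) :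
    fejerSum n u x = ∑ j ∈ s, (n j : ℂ) ^ (-(I * (u : ℂ))) * ((max (1 - n j * x) 0 : ℝ) : ℂ) := by
  refine tsum_eq_sum fun j hj => ?_
  rw [max_eq_right (sub_nonpos.2 (h j hj))]
  simp

lemma fejerSum_eq_zero {n : ℕ → ℝ} (hn1 : ∀ j, 1 ≤ n j) (u : ℝ) {x : ℝ} (hx : 1 ≤ x) :
    fejerSum n u x = 0 := by
  rw [fejerSum_eq_sum u (s := ∅) (fun j _ => one_le_mul_of_one_le_of_one_le (hn1 j) hx)]
  simp

lemma continuousOn_fejerSum {n : ℕ → ℝ} (hfin : ∀ x, {j | n j ≤ x}.Finite) (hn1 : ∀ j, 1 ≤ n j)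
    (u : ℝ) : ContinuousOn (fejerSum n u) (Ioi 0) := by
  intro x hx
  have hx : 0 < x := hx
  refine ContinuousAt.continuousWithinAt ?_
  have hev : fejerSum n u =ᶠ[𝓝 x] fun y => ∑ j ∈ (hfin (2 / x)).toFinset,
      (n j : ℂ) ^ (-(I * (u : ℂ))) * ((max (1 - n j * y) 0 : ℝ) : ℂ) := by
    filter_upwards [lt_mem_nhds (show x / 2 < x by linarith)] with y hy
    refine fejerSum_eq_sum u fun j hj => ?_
    have hj : 2 / x < n j := by simpa using hj
    have h0 := hn1 j
    rw [div_lt_iff₀ hx] at hj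
    nlinarith
  refine ContinuousAt.congr ?_ hev.symm
  fun_prop

lemma norm_cpow_neg_I_mul {a : ℝ} (ha : 0 < a) (u : ℝ) : ‖(a : ℂ) ^ (-(I * (u : ℂ)))‖ = 1 := by
  rw [norm_cpow_eq_rpow_re_of_pos ha]
  simp

lemma one_sub_I_mul_ne_zero (u : ℝ) : (1 : ℂ) - I * u ≠ 0 := fun h => by
  have := congrArg re h
  simp at this

lemma two_sub_I_mul_ne_zero (u : ℝ) : (2 : ℂ) - I * u ≠ 0 := fun h => by
  have := congrArg re h
  simp at this

lemma hasDerivAt_ofReal_cpow_of_pos (r : ℂ) {y : ℝ} (hy : 0 < y) :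
    HasDerivAt (fun y : ℝ => (y : ℂ) ^ r) (r * (y : ℂ) ^ (r - 1)) y := by
  have h := (hasDerivAt_id (y : ℂ)).cpow_const (c := r) (by simp [hy])
  simpa using h.comp_ofReal

/-- The derivative of the summand `y ^ (-iu) * (1 - y / X)`. -/
noncomputable def fejerDeriv (u X y : ℝ) : ℂ :=
  -(I * u) * (y : ℂ) ^ (-(I * (u : ℂ)) - 1) * (1 - y / X) - (y : ℂ) ^ (-(I * (u : ℂ))) / X

lemma hasDerivAt_fejer (u X : ℝ) {y : ℝ} (hy : 0 < y) :
    HasDerivAt (fun y : ℝ => (y : ℂ) ^ (-(I * (u : ℂ))) * (1 - y / X)) (fejerDeriv u X y) y := by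
  have h1 := hasDerivAt_ofReal_cpow_of_pos (-(I * (u : ℂ))) hy
  have h2 : HasDerivAt (fun y : ℝ => (1 : ℂ) - y / X) (-(1 / X)) y :=
    (((hasDerivAt_id y).ofReal_comp).div_const (X : ℂ)).const_sub 1 |>.congr_deriv (by simp)
  refine (h1.mul h2).congr_deriv ?_
  simp only [fejerDeriv]
  ring

lemma hasDerivAt_fejer_moment (u X : ℝ) {y : ℝ} (hy : 0 < y) :
    HasDerivAt (fun y : ℝ => -(I * u) / (1 - I * u) * (y : ℂ) ^ (1 - I * (u : ℂ)) -
      (1 - I * u) / (2 - I * u) / X * (y : ℂ) ^ (2 - I * (u : ℂ))) (y * fejerDeriv u X y) y := by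
  have h1 := hasDerivAt_ofReal_cpow_of_pos (1 - I * (u : ℂ)) hy
  have h2 := hasDerivAt_ofReal_cpow_of_pos (2 - I * (u : ℂ)) hy
  have h3 := (h1.const_mul (-(I * u) / (1 - I * u))).sub
    (h2.const_mul ((1 - I * u) / (2 - I * u) / X))
  refine h3.congr_deriv ?_
  have hy0 : (y : ℂ) ≠ 0 := by exact_mod_cast hy.ne'
  have e1 : (y : ℂ) ^ (1 - I * (u : ℂ) - 1) = (y : ℂ) ^ (-(I * (u : ℂ))) := by
    congr 1
    ring
  have e2 : (y : ℂ) ^ (2 - I * (u : ℂ) - 1) = y * (y : ℂ) ^ (-(I * (u : ℂ))) := by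
    rw [show 2 - I * (u : ℂ) - 1 = 1 + -(I * u) by ring, cpow_add _ _ hy0, cpow_one]
  have e3 : (y : ℂ) ^ (-(I * (u : ℂ))) = y * (y : ℂ) ^ (-(I * (u : ℂ)) - 1) := by
    rw [cpow_sub _ _ hy0, cpow_one]
    field_simp
  simp only [fejerDeriv]
  rw [e1, e2, e3]
  have := one_sub_I_mul_ne_zero u
  have := two_sub_I_mul_ne_zero u
  have f1 : -(I * (u : ℂ)) / (1 - I * u) * ((1 - I * u) * (y * (y : ℂ) ^ (-(I * (u : ℂ)) - 1))) =
      -(I * u) * (y * (y : ℂ) ^ (-(I * (u : ℂ)) - 1)) := by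
    field_simp
  have f2 : (1 - I * (u : ℂ)) / (2 - I * u) / X *
      ((2 - I * u) * (y * (y * (y : ℂ) ^ (-(I * (u : ℂ)) - 1)))) =
      (1 - I * u) / X * (y * (y * (y : ℂ) ^ (-(I * (u : ℂ)) - 1))) := by
    field_simp
  rw [f1, f2]
  ring

lemma continuousOn_fejerDeriv (u X : ℝ) : ContinuousOn (fejerDeriv u X) (Ioi 0) := by
  intro y hy
  refine ContinuousAt.continuousWithinAt ?_
  have h1 := (hasDerivAt_ofReal_cpow_of_pos (-(I * (u : ℂ))) hy).continuousAt
  have h2 := (hasDerivAt_ofReal_cpow_of_pos (-(I * (u : ℂ)) - 1) hy).continuousAt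
  unfold fejerDeriv
  fun_prop

lemma norm_fejerDeriv_le (u : ℝ) {X y : ℝ} (hy : 0 < y) (hyX : y ≤ X) :
    ‖fejerDeriv u X y‖ ≤ (1 + |u|) * y⁻¹ := by
  have hX : 0 < X := hy.trans_le hyX
  have h1 : ‖(y : ℂ) ^ (-(I * (u : ℂ)) - 1)‖ = y⁻¹ := by
    rw [norm_cpow_eq_rpow_re_of_pos hy]
    simp [Real.rpow_neg_one]
  have h2 : ‖(1 : ℂ) - y / X‖ ≤ 1 := by
    have : (1 : ℂ) - y / X = ((1 - y / X : ℝ) : ℂ) := by push_cast; rfl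
    rw [this, norm_real, Real.norm_eq_abs, abs_le]
    have : y / X ≤ 1 := (div_le_one hX).2 hyX
    have : 0 < y / X := by positivity
    constructor <;> linarith
  unfold fejerDeriv
  refine (norm_sub_le _ _).trans ?_
  rw [norm_mul, norm_mul, norm_div, h1, norm_cpow_neg_I_mul hy, norm_neg, norm_mul, norm_I,
    norm_real, norm_real, Real.norm_eq_abs, Real.norm_eq_abs, abs_of_pos hX, one_mul]
  have h3 : 1 / X ≤ y⁻¹ := by
    rw [one_div]
    exact inv_anti₀ hy hyX
  have h4 : |u| * y⁻¹ * ‖(1 : ℂ) - y / X‖ ≤ |u| * y⁻¹ * 1 := by gcongr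
  linarith

lemma fejer_eq_neg_integral (u : ℝ) {X a : ℝ} (ha : 0 < a) (haX : a ≤ X) :
    (a : ℂ) ^ (-(I * (u : ℂ))) * (1 - a / X) = -∫ y in a..X, fejerDeriv u X y := by
  have hX : 0 < X := ha.trans_le haX
  have hsub : uIcc a X ⊆ Ioi 0 := by
    rw [uIcc_of_le haX]
    exact fun y hy => ha.trans_le hy.1
  rw [intervalIntegral.integral_eq_sub_of_hasDerivAt
    (fun y hy => hasDerivAt_fejer u X (hsub hy))
    ((continuousOn_fejerDeriv u X).mono hsub).intervalIntegrable]
  have : (X : ℂ) ≠ 0 := by exact_mod_cast hX.ne'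
  simp [this]

lemma integrableOn_fejerDeriv (u : ℝ) (X : ℝ) :
    IntegrableOn (fejerDeriv u X) (Icc 1 X) :=
  ((continuousOn_fejerDeriv u X).mono
    fun _ hy => zero_lt_one.trans_le hy.1).integrableOn_compact isCompact_Icc

/-- Partial summation for the Fejér-type sum. -/
lemma fejerSum_eq_neg_integral {n : ℕ → ℝ} (hfin : ∀ x, {j | n j ≤ x}.Finite)
    (hn1 : ∀ j, 1 ≤ n j) (u : ℝ) {X : ℝ} (hX : 1 ≤ X) :
    IntegrableOn (fun y => ((({j | n j ≤ y}.ncard : ℕ) : ℝ) : ℂ) * fejerDeriv u X y) (Icc 1 X) ∧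
    fejerSum n u (1 / X) =
      -∫ y in Icc 1 X, ((({j | n j ≤ y}.ncard : ℕ) : ℝ) : ℂ) * fejerDeriv u X y := by
  have hX0 : 0 < X := by linarith
  set s := (hfin X).toFinset with hs
  have hmem : ∀ j, j ∈ s ↔ n j ≤ X := fun j => by simp [hs]
  have hcount : EqOn (fun y => ∑ j ∈ s, (Ici (n j)).indicator (fejerDeriv u X) y)
      (fun y => ((({j | n j ≤ y}.ncard : ℕ) : ℝ) : ℂ) * fejerDeriv u X y) (Icc 1 X) := by
    intro y hy
    have h1 : {j | n j ≤ y} = ((s.filter fun j => n j ≤ y : Finset ℕ) : Set ℕ) := by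
      ext j
      simp only [mem_ofPred_eq, Finset.coe_filter, hmem]
      exact ⟨fun h => ⟨h.trans hy.2, h⟩, fun h => h.2⟩
    simp only [h1, ncard_coe_finset, indicator_apply, mem_Ici]
    rw [← Finset.sum_filter, Finset.sum_const, nsmul_eq_mul]
    simp
  have hinteg : ∀ j ∈ s, IntegrableOn ((Ici (n j)).indicator (fejerDeriv u X)) (Icc 1 X) :=
    fun j _ => (integrableOn_fejerDeriv u X).indicator measurableSet_Ici
  refine ⟨IntegrableOn.congr_fun (integrable_finsetSum s hinteg) hcount measurableSet_Icc, ?_⟩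
  rw [← setIntegral_congr_fun measurableSet_Icc hcount, integral_finsetSum s hinteg,
    fejerSum_eq_sum u (s := s), ← Finset.sum_neg_distrib]
  · refine Finset.sum_congr rfl fun j hj => ?_
    have hj := (hmem j).1 hj
    have hj0 : 0 < n j := zero_lt_one.trans_le (hn1 j)
    have hset : Icc 1 X ∩ Ici (n j) = Icc (n j) X := by
      ext y
      simp only [mem_inter_iff, mem_Icc, mem_Ici]
      exact ⟨fun h => ⟨h.2, h.1.2⟩, fun h => ⟨⟨(hn1 j).trans h.1, h.2⟩, h.1⟩⟩
    rw [setIntegral_indicator measurableSet_Ici, hset, integral_Icc_eq_integral_Ioc,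
      ← intervalIntegral.integral_of_le hj, ← fejer_eq_neg_integral u hj0 hj, mul_one_div,
      max_eq_left (sub_nonneg.2 ((div_le_one hX0).2 hj))]
    push_cast
    rfl
  · intro j hj
    rw [hmem, not_le] at hj
    rw [mul_one_div, le_div_iff₀ hX0, one_mul]
    exact hj.le

/-- The residue factor `1 / ((1 - iu)(2 - iu))`. -/
noncomputable def fejerRes (u : ℝ) : ℂ := 1 / ((1 - I * u) * (2 - I * u))

lemma exists_fejerSum_sub_le {n : ℕ → ℝ} (hfin : ∀ x, {j | n j ≤ x}.Finite)
    (hn1 : ∀ j, 1 ≤ n j) {A C κ : ℝ} (hκ : 0 < κ)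
    (hE : ∀ x, 1 ≤ x → |({j | n j ≤ x}.ncard : ℝ) - A * x| ≤ C * x ^ κ) (u : ℝ) :
    ∃ K : ℝ, ∀ X : ℝ, 1 ≤ X →
      ‖fejerSum n u (1 / X) - A * fejerRes u * (X : ℂ) ^ (1 - I * (u : ℂ))‖ ≤ K * X ^ κ := by
  have hC : 0 ≤ C := by simpa using (abs_nonneg _).trans (hE 1 le_rfl)
  refine ⟨|A| * (‖-(I * u) / (1 - I * u)‖ + ‖(1 - I * (u : ℂ)) / (2 - I * u)‖) +
    C * (1 + |u|) / κ, fun X hX => ?_⟩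
  have hX0 : 0 < X := by linarith
  have hXC : (X : ℂ) ≠ 0 := by exact_mod_cast hX0.ne'
  obtain ⟨hinteg, heq⟩ := fejerSum_eq_neg_integral hfin hn1 u hX
  have hsub : Icc 1 X ⊆ Ioi 0 := fun y hy => zero_lt_one.trans_le hy.1
  have hc : ContinuousOn (fun y : ℝ => (y : ℂ) * fejerDeriv u X y) (Icc 1 X) :=
    continuous_ofReal.continuousOn.mul ((continuousOn_fejerDeriv u X).mono hsub)
  have hinteg2 : IntegrableOn (fun y : ℝ => (A : ℂ) * (y * fejerDeriv u X y)) (Icc 1 X) :=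
    (hc.integrableOn_compact isCompact_Icc).const_mul _
  have hmain : ∫ y in Icc 1 X, (y : ℂ) * fejerDeriv u X y =
      -(fejerRes u * (X : ℂ) ^ (1 - I * (u : ℂ))) -
        (-(I * u) / (1 - I * u) - (1 - I * u) / (2 - I * u) / X) := by
    rw [integral_Icc_eq_integral_Ioc, ← intervalIntegral.integral_of_le hX,
      intervalIntegral.integral_eq_sub_of_hasDerivAt
        (fun y hy => hasDerivAt_fejer_moment u X (hsub (uIcc_of_le hX ▸ hy)))
        (ContinuousOn.intervalIntegrable (by rwa [uIcc_of_le hX]))]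
    have e2 : (X : ℂ) ^ (2 - I * (u : ℂ)) = X * (X : ℂ) ^ (1 - I * (u : ℂ)) := by
      rw [show 2 - I * (u : ℂ) = 1 + (1 - I * u) by ring, cpow_add _ _ hXC, cpow_one]
    have := one_sub_I_mul_ne_zero u
    have := two_sub_I_mul_ne_zero u
    have e3 : -(I * (u : ℂ)) / (1 - I * u) - (1 - I * u) / (2 - I * u) = -fejerRes u := by
      rw [fejerRes]
      field_simp
      ring_nf
    have e4 : (1 - I * (u : ℂ)) / (2 - I * u) / X * (X * (X : ℂ) ^ (1 - I * (u : ℂ))) =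
        (1 - I * (u : ℂ)) / (2 - I * u) * (X : ℂ) ^ (1 - I * (u : ℂ)) := by
      field_simp
    rw [e2, e4, ← sub_mul, e3]
    simp
  have hdiff : fejerSum n u (1 / X) - A * fejerRes u * (X : ℂ) ^ (1 - I * (u : ℂ)) =
      A * (-(I * u) / (1 - I * u) - (1 - I * u) / (2 - I * u) / X) -
      ∫ y in Icc 1 X, ((({j | n j ≤ y}.ncard : ℝ) - A * y : ℝ) : ℂ) * fejerDeriv u X y := by
    have h1 : ∀ y : ℝ, ((({j | n j ≤ y}.ncard : ℝ) - A * y : ℝ) : ℂ) * fejerDeriv u X y =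
        ((({j | n j ≤ y}.ncard : ℕ) : ℝ) : ℂ) * fejerDeriv u X y -
          (A : ℂ) * (y * fejerDeriv u X y) := fun y => by
      push_cast
      ring
    simp only [h1]
    rw [integral_sub hinteg hinteg2, integral_const_mul, hmain, heq]
    ring
  have herr : ‖∫ y in Icc 1 X, ((({j | n j ≤ y}.ncard : ℝ) - A * y : ℝ) : ℂ) *
      fejerDeriv u X y‖ ≤ C * (1 + |u|) / κ * X ^ κ := by
    have hg : ContinuousOn (fun y : ℝ => C * (1 + |u|) * y ^ (κ - 1)) (Icc 1 X) := by
      refine continuousOn_const.mul (continuousOn_id.rpow_const fun y hy => Or.inl ?_)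
      exact (hsub hy).ne'
    refine (norm_integral_le_of_norm_le (hg.integrableOn_compact isCompact_Icc) ?_).trans ?_
    · refine (ae_restrict_iff' measurableSet_Icc).2 (Eventually.of_forall fun y hy => ?_)
      have hy0 : 0 < y := hsub hy
      rw [norm_mul, norm_real, Real.norm_eq_abs]
      calc _ ≤ C * y ^ κ * ((1 + |u|) * y⁻¹) :=
            mul_le_mul (hE y hy.1) (norm_fejerDeriv_le u hy0 hy.2) (norm_nonneg _) (by positivity)
        _ = _ := by
            rw [Real.rpow_sub_one hy0.ne']
            ring
    · rw [integral_const_mul, integral_Icc_eq_integral_Ioc, ← intervalIntegral.integral_of_le hX,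
        integral_rpow (Or.inl (by linarith))]
      simp only [sub_add_cancel, Real.one_rpow]
      rw [div_mul_eq_mul_div, mul_div_assoc]
      gcongr
      linarith
  rw [hdiff]
  refine (norm_sub_le _ _).trans ?_
  rw [add_mul]
  refine add_le_add ?_ herr
  have hXκ : 1 ≤ X ^ κ := Real.one_le_rpow hX hκ.le
  rw [norm_mul, norm_real, Real.norm_eq_abs, mul_assoc]
  gcongr
  refine (norm_sub_le _ _).trans ?_
  have h5 : ‖(1 - I * (u : ℂ)) / (2 - I * u) / X‖ ≤ ‖(1 - I * (u : ℂ)) / (2 - I * u)‖ := by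
    rw [norm_div _ (X : ℂ), norm_real, Real.norm_eq_abs, abs_of_pos hX0]
    exact div_le_self (norm_nonneg _) hX
  nlinarith [norm_nonneg (-(I * (u : ℂ)) / (1 - I * u)),
    norm_nonneg ((1 - I * (u : ℂ)) / (2 - I * u))]

lemma summable_rpow_neg_of_count {n : ℕ → ℝ} (hmono : Monotone n)
    (hfin : ∀ x, {j | n j ≤ x}.Finite) (hn1 : ∀ j, 1 ≤ n j) {A C κ : ℝ} (hA : 0 < A) (hκ : κ ≤ 1)
    (hE : ∀ x, 1 ≤ x → |({j | n j ≤ x}.ncard : ℝ) - A * x| ≤ C * x ^ κ) {σ : ℝ} (hσ : 1 < σ) :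
    Summable fun j => n j ^ (-σ) := by
  have hC : 0 ≤ C := by simpa using (abs_nonneg _).trans (hE 1 le_rfl)
  have hD : 0 < A + C := by linarith
  have hlow : ∀ j : ℕ, ((j : ℝ) + 1) / (A + C) ≤ n j := fun j => by
    have h0 : 0 < n j := zero_lt_one.trans_le (hn1 j)
    have h1 : j + 1 ≤ {i | n i ≤ n j}.ncard := by
      have h2 : ((Finset.range (j + 1) : Finset ℕ) : Set ℕ) ⊆ {i | n i ≤ n j} := fun i hi => by
        simp only [Finset.coe_range, mem_Iio] at hi
        exact hmono (by omega)
      simpa using ncard_le_ncard h2 (hfin _)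
    have h2 : ((j : ℝ) + 1) ≤ ({i | n i ≤ n j}.ncard : ℝ) := by exact_mod_cast h1
    have h3 := (abs_le.1 (hE (n j) (hn1 j))).2
    have h4 : n j ^ κ ≤ n j := by
      simpa using Real.rpow_le_rpow_of_exponent_le (hn1 j) hκ
    have h5 : C * n j ^ κ ≤ C * n j := by gcongr
    rw [div_le_iff₀ hD]
    linarith
  have hs : Summable fun j : ℕ => (A + C) ^ σ * (((j + 1 : ℕ) : ℝ) ^ (-σ)) :=
    ((summable_nat_add_iff 1).2 (Real.summable_nat_rpow.2 (by linarith))).mul_left _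
  refine Summable.of_nonneg_of_le
    (fun j => Real.rpow_nonneg (zero_le_one.trans (hn1 j)) _) (fun j => ?_) hs
  have hj : (0 : ℝ) < (j : ℝ) + 1 := by positivity
  calc n j ^ (-σ) ≤ (((j : ℝ) + 1) / (A + C)) ^ (-σ) :=
        Real.rpow_le_rpow_of_nonpos (by positivity) (hlow j) (by linarith)
    _ = _ := by
        rw [Real.div_rpow hj.le hD.le, Real.rpow_neg hD.le, div_inv_eq_mul, mul_comm]
        push_cast
        rfl

lemma integral_norm_one_sub_mul_max {a : ℝ} (ha : 0 < a) {s : ℂ} (hs : 0 < s.re) (u : ℝ) :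
    ∫ x in Ioi (0 : ℝ), ‖(x : ℂ) ^ (s - 1) •
      ((a : ℂ) ^ (-(I * (u : ℂ))) * ((max (1 - a * x) 0 : ℝ) : ℂ))‖ =
      a ^ (-s.re) * (1 / (s.re * (s.re + 1))) := by
  have h := (hasMellin_one_sub_mul_max ha (s := (s.re : ℂ)) (by simpa using hs)).2
  have h2 : ∀ x ∈ Ioi (0 : ℝ), (x : ℂ) ^ ((s.re : ℂ) - 1) • ((max (1 - a * x) 0 : ℝ) : ℂ) =
      ((‖(x : ℂ) ^ (s - 1) •
      ((a : ℂ) ^ (-(I * (u : ℂ))) * ((max (1 - a * x) 0 : ℝ) : ℂ))‖ : ℝ) : ℂ) := fun x hx => by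
    have hx : 0 < x := hx
    rw [norm_smul, norm_mul, norm_cpow_neg_I_mul ha, one_mul, norm_cpow_eq_rpow_re_of_pos hx,
      norm_real, Real.norm_eq_abs, abs_of_nonneg (le_max_right _ _), smul_eq_mul, ofReal_mul,
      ofReal_cpow hx.le]
    simp
  rw [mellin, setIntegral_congr_fun measurableSet_Ioi h2, integral_complex_ofReal] at h
  have h3 : ((a : ℂ) ^ (-(s.re : ℂ)) * (1 / ((s.re : ℂ) * (s.re + 1)))) =
      ((a ^ (-s.re) * (1 / (s.re * (s.re + 1))) : ℝ) : ℂ) := by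
    push_cast
    rw [ofReal_cpow ha.le]
    simp
  rw [h3] at h
  exact_mod_cast h

lemma mellin_fejerSum_of_summable {n : ℕ → ℝ} (hn1 : ∀ j, 1 ≤ n j) (u : ℝ) {s : ℂ}
    (hs : 0 < s.re) (hsum : Summable fun j => n j ^ (-s.re)) :
    mellin (fejerSum n u) s =
      (∑' j, (n j : ℂ) ^ (-(s + I * u))) * (1 / (s * (s + 1))) := by
  have hpos : ∀ j, 0 < n j := fun j => zero_lt_one.trans_le (hn1 j)
  have hinteg : ∀ j, IntegrableOn (fun x : ℝ => (x : ℂ) ^ (s - 1) •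
      ((n j : ℂ) ^ (-(I * (u : ℂ))) * ((max (1 - n j * x) 0 : ℝ) : ℂ))) (Ioi 0) := fun j =>
    (hasMellin_one_sub_mul_max (hpos j) hs).1.const_smul ((n j : ℂ) ^ (-(I * (u : ℂ))))
  have h1 := hasSum_integral_of_summable_integral_norm hinteg (by
    simp only [integral_norm_one_sub_mul_max (hpos _) hs u]
    exact hsum.mul_right _)
  have h2 : mellin (fejerSum n u) s = ∫ x in Ioi (0 : ℝ), ∑' j, (x : ℂ) ^ (s - 1) •
      ((n j : ℂ) ^ (-(I * (u : ℂ))) * ((max (1 - n j * x) 0 : ℝ) : ℂ)) := by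
    simp only [mellin, fejerSum, smul_eq_mul, tsum_mul_left]
  rw [h2, ← h1.tsum_eq, ← tsum_mul_right]
  refine tsum_congr fun j => ?_
  have hj : (n j : ℂ) ≠ 0 := by exact_mod_cast (hpos j).ne'
  have h3 := (hasMellin_const_smul (hasMellin_one_sub_mul_max (hpos j) hs).1
    ((n j : ℂ) ^ (-(I * (u : ℂ))))).2
  rw [(hasMellin_one_sub_mul_max (hpos j) hs).2, smul_eq_mul, ← mul_assoc, ← cpow_add _ _ hj] at h3
  rw [show -(s + I * (u : ℂ)) = -(I * u) + -s by ring]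
  exact h3

lemma hasMellin_cpow_indicator_Ioi_one {a s : ℂ} (h : (s + a).re < 0) :
    HasMellin ((Ioi (1 : ℝ)).indicator fun t : ℝ => (t : ℂ) ^ a) s (-(1 / (s + a))) := by
  have hlt : (s - 1 + a).re < -1 := by
    simp only [add_re, sub_re, one_re] at h ⊢
    linarith
  have heq : ∀ t : ℝ, (t : ℂ) ^ (s - 1) • (Ioi (1 : ℝ)).indicator (fun t : ℝ => (t : ℂ) ^ a) t =
      (Ioi (1 : ℝ)).indicator (fun t : ℝ => (t : ℂ) ^ (s - 1 + a)) t := fun t => by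
    by_cases ht : t ∈ Ioi (1 : ℝ)
    · have : (t : ℂ) ≠ 0 := by exact_mod_cast (zero_lt_one.trans ht).ne'
      simp only [indicator_of_mem ht, smul_eq_mul, cpow_add _ _ this]
    · simp only [indicator_of_notMem ht, smul_zero]
  refine ⟨?_, ?_⟩
  · rw [MellinConvergent]
    simp only [heq]
    exact ((integrableOn_Ioi_cpow_of_lt hlt one_pos).integrable_indicator
      measurableSet_Ioi).integrableOn
  · rw [mellin]
    simp only [heq]
    rw [setIntegral_indicator measurableSet_Ioi, Ioi_inter_Ioi, max_eq_right zero_le_one,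
      integral_Ioi_cpow_of_lt hlt one_pos, ofReal_one, one_cpow,
      show s - 1 + a + 1 = s + a by ring, neg_div]

/-- The Fejér-type sum minus its main term. -/
noncomputable def fejerRem (n : ℕ → ℝ) (A u x : ℝ) : ℂ :=
  fejerSum n u x - A * fejerRes u * (x : ℂ) ^ (I * (u : ℂ) - 1)

lemma continuousOn_fejerRem {n : ℕ → ℝ} (hfin : ∀ x, {j | n j ≤ x}.Finite) (hn1 : ∀ j, 1 ≤ n j)
    (A u : ℝ) : ContinuousOn (fejerRem n A u) (Ioi 0) := by
  refine (continuousOn_fejerSum hfin hn1 u).sub (continuousOn_const.mul fun x hx => ?_)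
  exact (hasDerivAt_ofReal_cpow_of_pos _ hx).continuousAt.continuousWithinAt

lemma exists_fejerRem_le {n : ℕ → ℝ} (hfin : ∀ x, {j | n j ≤ x}.Finite)
    (hn1 : ∀ j, 1 ≤ n j) {A C κ : ℝ} (hκ : 0 < κ)
    (hE : ∀ x, 1 ≤ x → |({j | n j ≤ x}.ncard : ℝ) - A * x| ≤ C * x ^ κ) (u : ℝ) :
    ∃ K : ℝ, ∀ x : ℝ, 0 < x → x ≤ 1 → ‖fejerRem n A u x‖ ≤ K * x ^ (-κ) := by
  obtain ⟨K, hK⟩ := exists_fejerSum_sub_le hfin hn1 hκ hE u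
  refine ⟨K, fun x hx hx1 => ?_⟩
  have h := hK (1 / x) (one_le_one_div hx hx1)
  have h1 : ((1 / x : ℝ) : ℂ) ^ (1 - I * (u : ℂ)) = (x : ℂ) ^ (I * (u : ℂ) - 1) := by
    rw [one_div, ofReal_inv, inv_cpow _ _ (by
      rw [arg_ofReal_of_nonneg hx.le]
      exact Real.pi_pos.ne), ← cpow_neg, neg_sub]
  rw [one_div_one_div, h1, one_div, Real.inv_rpow hx.le, ← Real.rpow_neg hx.le] at h
  exact h

section Continuation

variable {n : ℕ → ℝ} (hmono : Monotone n) (hfin : ∀ x, {j | n j ≤ x}.Finite)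
  (hn1 : ∀ j, 1 ≤ n j) {A C κ : ℝ} (hA : 0 < A) (hκ : 0 < κ) (hκ1 : κ < 1)
  (hE : ∀ x, 1 ≤ x → |({j | n j ≤ x}.ncard : ℝ) - A * x| ≤ C * x ^ κ)

include hfin hn1 hκ hE in
lemma fejerRem_indicator_mellin (u : ℝ) {s : ℂ} (hs : κ < s.re) :
    MellinConvergent ((Ioc (0 : ℝ) 1).indicator (fejerRem n A u)) s ∧
      DifferentiableAt ℂ (mellin ((Ioc (0 : ℝ) 1).indicator (fejerRem n A u))) s := by
  obtain ⟨K, hK⟩ := exists_fejerRem_le hfin hn1 hκ hE u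
  have hloc : LocallyIntegrableOn ((Ioc (0 : ℝ) 1).indicator (fejerRem n A u)) (Ioi 0) := by
    have h := (continuousOn_fejerRem hfin hn1 A u).locallyIntegrableOn (μ := volume)
      measurableSet_Ioi
    intro x hx
    obtain ⟨t, ht, hti⟩ := h x hx
    exact ⟨t, ht, hti.indicator measurableSet_Ioc⟩
  have htop : (Ioc (0 : ℝ) 1).indicator (fejerRem n A u) =O[atTop]
      fun x : ℝ => x ^ (-(s.re + 1)) := by
    refine (isBigO_zero _ _).congr' ?_ EventuallyEq.rfl
    filter_upwards [eventually_gt_atTop 1] with x hx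
    rw [indicator_of_notMem fun h => (not_le.2 hx) h.2]
  have hzero : (Ioc (0 : ℝ) 1).indicator (fejerRem n A u) =O[𝓝[>] 0]
      fun x : ℝ => x ^ (-κ) := by
    refine IsBigO.of_bound K ?_
    filter_upwards [Ioc_mem_nhdsGT zero_lt_one] with x hx
    rw [indicator_of_mem hx, Real.norm_of_nonneg (Real.rpow_nonneg hx.1.le _)]
    exact hK x hx.1 hx.2
  exact ⟨mellinConvergent_of_isBigO_rpow hloc htop (by linarith) hzero hs,
    mellin_differentiableAt_of_isBigO_rpow hloc htop (by linarith) hzero hs⟩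

include hmono hfin hn1 hA hκ hκ1 hE in
lemma mellin_fejerRem_indicator (u : ℝ) {s : ℂ} (hs : 1 < s.re) :
    mellin ((Ioc (0 : ℝ) 1).indicator (fejerRem n A u)) s =
      (∑' j, (n j : ℂ) ^ (-(s + I * u))) * (1 / (s * (s + 1))) -
        A * fejerRes u * (1 / (s + (I * u - 1))) := by
  have h1 := (fejerRem_indicator_mellin hfin hn1 hκ hE u (hκ1.trans hs)).1
  have h2 := hasMellin_cpow_Ioc (I * (u : ℂ) - 1) (s := s) (by simp; linarith)
  have h3 := hasMellin_const_smul h2.1 (A * fejerRes u)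
  have h4 := hasMellin_add h1 h3.1
  have h5 := h4.congr_Ioi (g := fejerSum n u) fun x hx => by
    by_cases hx1 : x ≤ 1
    · have : x ∈ Ioc (0 : ℝ) 1 := ⟨hx, hx1⟩
      simp [this, fejerRem]
    · have : x ∉ Ioc (0 : ℝ) 1 := fun h => hx1 h.2
      simp [this, fejerSum_eq_zero hn1 u (not_le.1 hx1).le]
  have h6 := h5.2
  rw [mellin_fejerSum_of_summable hn1 u (by linarith)
    (summable_rpow_neg_of_count hmono hfin hn1 hA hκ1.le hE hs), h3.2, h2.2, smul_eq_mul] at h6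
  rw [h6]
  ring

include hmono hfin hn1 hA hκ hκ1 hE in
/-- The Mellin transform of the remainder in the strip `κ < Re s < 1` is
`Z (s + iu) / (s (s + 1))`. -/
lemma hasMellin_fejerRem {Z : ℂ → ℂ}
    (hZ : ∀ s : ℂ, 1 < s.re → Z s = ∑' j : ℕ, (n j : ℂ) ^ (-s))
    (hd : DifferentiableOn ℂ (fun s => Z s - (A : ℂ) / (s - 1)) {s : ℂ | κ < s.re})
    (u : ℝ) {s : ℂ} (hs : κ < s.re) (hs1 : s.re < 1) :
    HasMellin (fejerRem n A u) s (Z (s + I * u) * (1 / (s * (s + 1)))) := by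
  set H := mellin ((Ioc (0 : ℝ) 1).indicator (fejerRem n A u)) with hH
  set g : ℂ → ℂ := fun s => Z s - (A : ℂ) / (s - 1) with hg
  set U : Set ℂ := {s : ℂ | κ < s.re} with hU
  have hUo : IsOpen U := isOpen_lt continuous_const continuous_re
  have hUc : IsPreconnected U := (convex_halfSpace_re_gt κ).isPreconnected
  have hne : ∀ s ∈ U, s * (s + 1) ≠ 0 := fun s hs => by
    have hs : κ < s.re := hs
    refine mul_ne_zero (fun h => ?_) (fun h => ?_)
    · rw [h] at hs
      simp at hs
      linarith
    · have := congrArg re h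
      simp at this
      linarith
  have hl : DifferentiableOn ℂ (fun s => (s + (I * u - 1)) * H s) U := fun s hs =>
    ((differentiableAt_id.add_const _).mul
      (fejerRem_indicator_mellin hfin hn1 hκ hE u hs).2).differentiableWithinAt
  have hshift : MapsTo (fun s : ℂ => s + I * u) U U := fun s hs => by
    simpa [hU] using hs
  have hr : DifferentiableOn ℂ (fun s => (g (s + I * u) * (s + (I * u - 1)) + A) *
      (s * (s + 1))⁻¹ - A * fejerRes u) U := by
    have h1 : DifferentiableOn ℂ (fun s => g (s + I * u)) U :=
      hd.comp (differentiableOn_id.add_const _) hshift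
    have h2 : DifferentiableOn ℂ (fun s : ℂ => (s * (s + 1))⁻¹) U :=
      DifferentiableOn.inv (by fun_prop) hne
    have h3 : DifferentiableOn ℂ (fun s : ℂ => s + (I * u - 1)) U := by fun_prop
    exact (((h1.mul h3).add_const _).mul h2).sub_const _
  have h2U : (2 : ℂ) ∈ U := by
    simp only [hU, mem_ofPred_eq, re_ofNat]
    linarith
  have hev : (fun s => (s + (I * u - 1)) * H s) =ᶠ[𝓝 2]
      fun s => (g (s + I * u) * (s + (I * u - 1)) + A) * (s * (s + 1))⁻¹ - A * fejerRes u := by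
    have : ∀ᶠ s : ℂ in 𝓝 2, 1 < s.re :=
      (isOpen_lt continuous_const continuous_re).mem_nhds (by simp)
    filter_upwards [this] with s hs
    have h1 : s + (I * u - 1) ≠ 0 := fun h => by
      have := congrArg re h
      simp at this
      linarith
    have h2 : s + I * u - 1 ≠ 0 := by rwa [add_sub_assoc]
    rw [hH, mellin_fejerRem_indicator hmono hfin hn1 hA hκ hκ1 hE u hs, hg]
    simp only
    rw [hZ (s + I * u) (by simpa using hs), ← add_sub_assoc]
    field_simp
    ring
  have key := (hl.analyticOnNhd hUo).eqOn_of_preconnected_of_eventuallyEq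
    (hr.analyticOnNhd hUo) hUc h2U hev hs
  have h1 : s + (I * u - 1) ≠ 0 := fun h => by
    have := congrArg re h
    simp at this
    linarith
  have hHs : H s = Z (s + I * u) * (1 / (s * (s + 1))) - A * fejerRes u * (1 / (s + (I * u - 1))) := by
    apply mul_left_cancel₀ h1
    simp only [hg] at key
    rw [key, ← add_sub_assoc]
    rw [← add_sub_assoc] at h1
    have := hne s hs
    field_simp
    ring
  have h2 := hasMellin_cpow_indicator_Ioi_one (a := I * (u : ℂ) - 1) (s := s) (by
    simp
    linarith)
  have h3 := hasMellin_const_smul h2.1 (A * fejerRes u)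
  have h4 := hasMellin_sub (fejerRem_indicator_mellin hfin hn1 hκ hE u hs).1 h3.1
  have h5 := h4.congr_Ioi (g := fejerRem n A u) fun x hx => by
    by_cases hx1 : x ≤ 1
    · have : x ∈ Ioc (0 : ℝ) 1 := ⟨hx, hx1⟩
      have h' : x ∉ Ioi (1 : ℝ) := fun h => (not_le.2 h) hx1
      simp only [indicator_of_mem this, indicator_of_notMem h', smul_zero, sub_zero]
    · have : x ∉ Ioc (0 : ℝ) 1 := fun h => hx1 h.2
      have h' : x ∈ Ioi (1 : ℝ) := not_le.1 hx1
      simp only [indicator_of_notMem this, indicator_of_mem h', fejerRem,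
        fejerSum_eq_zero hn1 u (not_le.1 hx1).le, smul_eq_mul]
  rw [← hH, hHs, h3.2, h2.2, smul_eq_mul] at h5
  convert h5 using 1
  ring

end Continuation

lemma norm_fejerRes_le (u : ℝ) : ‖fejerRes u‖ ≤ 1 / (1 + u ^ 2) := by
  have hsq : ∀ a : ℝ, ‖(a : ℂ) - I * u‖ = √(a ^ 2 + u ^ 2) := fun a => by
    rw [norm_def, normSq_apply]
    congr 1
    simp
    ring
  have h1 := hsq 1
  have h2 := hsq 2
  push_cast at h1 h2
  rw [fejerRes, norm_div, norm_mul, h1, h2, norm_one]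
  refine one_div_le_one_div_of_le (by positivity) ?_
  calc 1 + u ^ 2 = √(1 ^ 2 + u ^ 2) * √(1 ^ 2 + u ^ 2) := by
        rw [Real.mul_self_sqrt (by positivity)]
        ring
    _ ≤ _ := by
        gcongr
        norm_num

lemma norm_one_div_mul_add_one_le {σ : ℝ} (hσ : 1 / 2 ≤ σ) (y : ℝ) :
    ‖1 / (((σ : ℂ) + y * I) * ((σ : ℂ) + y * I + 1))‖ ≤ 9 * (1 + |y|) ^ (-2 : ℝ) := by
  have hre : |σ| ≤ ‖(σ : ℂ) + y * I‖ := by simpa using abs_re_le_norm ((σ : ℂ) + y * I)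
  have him : |y| ≤ ‖(σ : ℂ) + y * I‖ := by simpa using abs_im_le_norm ((σ : ℂ) + y * I)
  have hre' : |σ + 1| ≤ ‖(σ : ℂ) + y * I + 1‖ := by
    simpa using abs_re_le_norm ((σ : ℂ) + y * I + 1)
  have him' : |y| ≤ ‖(σ : ℂ) + y * I + 1‖ := by
    simpa using abs_im_le_norm ((σ : ℂ) + y * I + 1)
  rw [abs_of_nonneg (by linarith)] at hre hre'
  have h1 : (1 + |y|) / 3 ≤ ‖(σ : ℂ) + y * I‖ := by linarith
  have h2 : (1 + |y|) / 3 ≤ ‖(σ : ℂ) + y * I + 1‖ := by linarith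
  have hy : 0 < 1 + |y| := by positivity
  rw [norm_div, norm_mul, norm_one, Real.rpow_neg hy.le, Real.rpow_two, ← div_eq_mul_inv]
  calc 1 / (‖(σ : ℂ) + y * I‖ * ‖(σ : ℂ) + y * I + 1‖)
      ≤ 1 / ((1 + |y|) / 3 * ((1 + |y|) / 3)) := by gcongr
    _ = 9 / (1 + |y|) ^ 2 := by
        field_simp
        norm_num

section Bound

variable {n : ℕ → ℝ} (hmono : Monotone n) (hfin : ∀ x, {j | n j ≤ x}.Finite)
  (hn1 : ∀ j, 1 ≤ n j) {A C κ : ℝ} (hA : 0 < A) (hκ : 0 < κ) (hκ1 : κ < 1)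
  (hE : ∀ x, 1 ≤ x → |({j | n j ≤ x}.ncard : ℝ) - A * x| ≤ C * x ^ κ)

include hmono hfin hn1 hA hκ hκ1 hE in
lemma exists_norm_fejerRem_le {Z : ℂ → ℂ}
    (hZ : ∀ s : ℂ, 1 < s.re → Z s = ∑' j : ℕ, (n j : ℂ) ^ (-s))
    (hd : DifferentiableOn ℂ (fun s => Z s - (A : ℂ) / (s - 1)) {s : ℂ | κ < s.re})
    {σ B CB : ℝ} (hκσ : κ < σ) (hσ : 1 / 2 ≤ σ) (hσ1 : σ < 1) (hB0 : 0 ≤ B) (hB : B ≤ 1 / 2)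
    (hsub : ∀ t : ℝ, ‖Z ((σ : ℂ) + I * t)‖ ≤ CB * (1 + |t|) ^ B) :
    ∃ K : ℝ, 0 ≤ K ∧ ∀ u X : ℝ, 0 < X →
      ‖fejerRem n A u (1 / X)‖ ≤ K * (X ^ σ * (1 + |u|) ^ B) := by
  have hCB : 0 ≤ CB := by simpa using (norm_nonneg _).trans (hsub 0)
  have hint0 : Integrable fun y : ℝ => (1 + |y|) ^ (-(3 / 2) : ℝ) := by
    simpa using integrable_one_add_norm (E := ℝ) (μ := volume) (r := 3 / 2) (by norm_num)
  have hMnn : 0 ≤ ∫ y : ℝ, (1 + |y|) ^ (-(3 / 2) : ℝ) :=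
    integral_nonneg fun y => by positivity
  refine ⟨1 / (2 * Real.pi) * (9 * CB * ∫ y : ℝ, (1 + |y|) ^ (-(3 / 2) : ℝ)),
    by positivity, fun u X hX => ?_⟩
  have hre : ∀ y : ℝ, ((σ : ℂ) + y * I).re = σ := fun y => by simp
  have hmel : ∀ y : ℝ, HasMellin (fejerRem n A u) ((σ : ℂ) + y * I)
      (Z ((σ : ℂ) + y * I + I * u) *
        (1 / (((σ : ℂ) + y * I) * ((σ : ℂ) + y * I + 1)))) := fun y =>
    hasMellin_fejerRem hmono hfin hn1 hA hκ hκ1 hE hZ hd u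
      (by rwa [hre]) (by rwa [hre])
  have hbound : ∀ y : ℝ, ‖mellin (fejerRem n A u) ((σ : ℂ) + y * I)‖ ≤
      9 * CB * (1 + |u|) ^ B * (1 + |y|) ^ (-(3 / 2) : ℝ) := fun y => by
    have hy : 0 < 1 + |y| := by positivity
    have hu : 0 < 1 + |u| := by positivity
    rw [(hmel y).2, norm_mul]
    have h1 := hsub (y + u)
    have e1 : (σ : ℂ) + I * ((y + u : ℝ) : ℂ) = (σ : ℂ) + y * I + I * u := by
      push_cast
      ring
    rw [e1] at h1
    have h2 : (1 + |y + u|) ^ B ≤ (1 + |u|) ^ B * (1 + |y|) ^ B := by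
      rw [← Real.mul_rpow hu.le hy.le]
      refine Real.rpow_le_rpow (by positivity) ?_ hB0
      nlinarith [abs_add_le y u, abs_nonneg y, abs_nonneg u]
    have h3 : (1 + |y|) ^ B * (1 + |y|) ^ (-2 : ℝ) ≤ (1 + |y|) ^ (-(3 / 2) : ℝ) := by
      rw [← Real.rpow_add hy]
      exact Real.rpow_le_rpow_of_exponent_le (by linarith [abs_nonneg y]) (by linarith)
    calc _ ≤ (CB * ((1 + |u|) ^ B * (1 + |y|) ^ B)) * (9 * (1 + |y|) ^ (-2 : ℝ)) := by
          refine mul_le_mul (h1.trans (by gcongr)) (norm_one_div_mul_add_one_le hσ y)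
            (norm_nonneg _) (by positivity)
      _ = 9 * CB * (1 + |u|) ^ B * ((1 + |y|) ^ B * (1 + |y|) ^ (-2 : ℝ)) := by ring
      _ ≤ _ := by gcongr
  have hcont : Continuous fun y : ℝ => mellin (fejerRem n A u) ((σ : ℂ) + y * I) := by
    have hne1 : ∀ y : ℝ, (σ : ℂ) + y * I + I * u - 1 ≠ 0 := fun y h => by
      have := congrArg re h
      simp at this
      linarith
    have hg : Continuous fun y : ℝ => Z ((σ : ℂ) + y * I + I * u) -
        (A : ℂ) / ((σ : ℂ) + y * I + I * u - 1) :=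
      hd.continuousOn.comp_continuous (f := fun y : ℝ => (σ : ℂ) + y * I + I * u)
        (by fun_prop) (fun y => by simpa using hκσ)
    have hq : Continuous fun y : ℝ => (A : ℂ) / ((σ : ℂ) + y * I + I * u - 1) :=
      Continuous.div (by fun_prop) (by fun_prop) hne1
    have hk : Continuous fun y : ℝ => 1 / (((σ : ℂ) + y * I) * ((σ : ℂ) + y * I + 1)) := by
      refine Continuous.div (by fun_prop) (by fun_prop) fun y => mul_ne_zero (fun h => ?_)
        (fun h => ?_)
      all_goals
        have := congrArg re h
        simp at this
        linarith
    refine ((hg.add hq).mul hk).congr fun y => ?_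
    simp only [(hmel y).2, Pi.mul_apply, Pi.add_apply, sub_add_cancel]
  have hdom : Integrable fun y : ℝ =>
      9 * CB * (1 + |u|) ^ B * (1 + |y|) ^ (-(3 / 2) : ℝ) := hint0.const_mul _
  have hvert : VerticalIntegrable (mellin (fejerRem n A u)) σ :=
    hdom.mono' hcont.aestronglyMeasurable (Eventually.of_forall hbound)
  have hX' : 0 < 1 / X := by positivity
  have hinv := mellinInv_mellin_eq σ (fejerRem n A u) hX' (by simpa using (hmel 0).1) hvert
    ((continuousOn_fejerRem hfin hn1 A u).continuousAt (Ioi_mem_nhds hX'))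
  rw [← hinv, mellinInv, norm_smul, Real.norm_of_nonneg (by positivity), mul_assoc]
  refine mul_le_mul_of_nonneg_left ?_ (by positivity)
  refine (norm_integral_le_of_norm_le (hdom.const_mul (X ^ σ))
    (Eventually.of_forall fun y => ?_)).trans (le_of_eq ?_)
  · rw [norm_smul, norm_cpow_eq_rpow_re_of_pos hX', neg_re, hre, one_div, Real.inv_rpow hX.le,
      Real.rpow_neg hX.le, inv_inv]
    exact mul_le_mul_of_nonneg_left (hbound y) (by positivity)
  · rw [integral_const_mul, integral_const_mul]
    ring

include hmono hfin hn1 hA hκ hκ1 hE in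
lemma exists_norm_fejerSum_le {Z : ℂ → ℂ}
    (hZ : ∀ s : ℂ, 1 < s.re → Z s = ∑' j : ℕ, (n j : ℂ) ^ (-s))
    (hd : DifferentiableOn ℂ (fun s => Z s - (A : ℂ) / (s - 1)) {s : ℂ | κ < s.re})
    {σ B CB : ℝ} (hκσ : κ < σ) (hσ : 1 / 2 ≤ σ) (hσ1 : σ < 1) (hB0 : 0 ≤ B) (hB : B ≤ 1 / 2)
    (hsub : ∀ t : ℝ, ‖Z ((σ : ℂ) + I * t)‖ ≤ CB * (1 + |t|) ^ B) :
    ∃ K : ℝ, 0 ≤ K ∧ ∀ u X : ℝ, 0 < X →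
      ‖fejerSum n u (1 / X)‖ ≤ K * (X * (1 / (1 + u ^ 2)) + X ^ σ * (1 + |u|) ^ B) := by
  obtain ⟨K, hK0, hK⟩ := exists_norm_fejerRem_le hmono hfin hn1 hA hκ hκ1 hE hZ hd hκσ hσ hσ1
    hB0 hB hsub
  refine ⟨A + K, by positivity, fun u X hX => ?_⟩
  have h1 : fejerSum n u (1 / X) = A * fejerRes u * ((1 / X : ℝ) : ℂ) ^ (I * (u : ℂ) - 1) +
      fejerRem n A u (1 / X) := by
    rw [fejerRem]
    ring
  have h2 : ‖((1 / X : ℝ) : ℂ) ^ (I * (u : ℂ) - 1)‖ = X := by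
    rw [norm_cpow_eq_rpow_re_of_pos (by positivity)]
    simp [Real.rpow_neg_one]
  rw [h1]
  refine (norm_add_le _ _).trans ?_
  rw [norm_mul, norm_mul, h2, norm_real, Real.norm_eq_abs, abs_of_pos hA]
  have h3 := hK u X hX
  have h4 : A * ‖fejerRes u‖ * X ≤ A * (1 / (1 + u ^ 2)) * X := by
    gcongr
    exact norm_fejerRes_le u
  have h5 : 0 ≤ X * (1 / (1 + u ^ 2)) := by positivity
  have h6 : 0 ≤ X ^ σ * (1 + |u|) ^ B := by positivity
  nlinarith [mul_nonneg hK0 h5, mul_nonneg hA.le h6]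

end Bound

/-- Sums of `1 / (1 + u²)` over differences of `1`-well-spaced points are bounded. -/
lemma exists_sum_wellSpaced_le : ∃ W : ℝ, 0 ≤ W ∧ ∀ (R : ℕ) (t : Fin R → ℝ),
    (∀ r s : Fin R, r ≠ s → 1 ≤ |t r - t s|) →
    ∀ r, ∑ s, 1 / (1 + (t r - t s) ^ 2) ≤ W := by
  have hsum : Summable fun k : ℤ => 3 / (1 + (k : ℝ) ^ 2) := by
    have h := (Real.summable_one_div_int_pow (p := 2)).2 one_lt_two
    refine Summable.of_norm_bounded_eventually (h.mul_left 3) ?_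
    rw [Filter.eventually_cofinite]
    refine (finite_singleton (0 : ℤ)).subset fun k hk => ?_
    by_contra h0
    refine hk ?_
    have hk0 : (0 : ℝ) < (k : ℝ) ^ 2 := by
      have : (k : ℝ) ≠ 0 := by exact_mod_cast h0
      positivity
    rw [Real.norm_of_nonneg (by positivity), mul_one_div]
    gcongr
    linarith
  refine ⟨∑' k : ℤ, 3 / (1 + (k : ℝ) ^ 2), tsum_nonneg fun k => by positivity,
    fun R t ht r => ?_⟩
  have hinj : Function.Injective fun s => ⌊t r - t s⌋ := fun s s' h => by
    by_contra hne
    have h1 := Int.abs_sub_lt_one_of_floor_eq_floor h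
    have h2 := ht s' s (Ne.symm hne)
    rw [sub_sub_sub_cancel_left] at h1
    linarith
  calc ∑ s, 1 / (1 + (t r - t s) ^ 2)
      ≤ ∑ s, 3 / (1 + (⌊t r - t s⌋ : ℝ) ^ 2) := by
        refine Finset.sum_le_sum fun s _ => ?_
        rw [div_le_div_iff₀ (by positivity) (by positivity)]
        have h1 := Int.floor_le (t r - t s)
        have h2 := Int.lt_floor_add_one (t r - t s)
        set v := t r - t s
        set k : ℝ := (⌊v⌋ : ℝ)
        nlinarith [sq_nonneg (v - k), sq_nonneg (2 * v - k), mul_nonneg (sub_nonneg.2 h1)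
          (sub_nonneg.2 h2.le)]
    _ = ∑' s, 3 / (1 + (⌊t r - t s⌋ : ℝ) ^ 2) := (tsum_fintype _).symm
    _ ≤ _ := (hsum.comp_injective hinj).tsum_le_tsum_of_inj _ hinj (fun _ _ => by positivity)
        (fun _ => le_rfl) hsum

/-- Weighted duality (Halász–Montgomery) inequality for finite families of vectors. -/
lemma sum_norm_sq_le_of_row_sums {ι : Type*} [Fintype ι] {J s : Finset ℕ} (hJs : J ⊆ s)
    (b : ℕ → ℝ) (hb : ∀ j ∈ s, 0 ≤ b j) (hbJ : ∀ j ∈ J, 1 / 2 ≤ b j) (e : ι → ℕ → ℂ)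
    (a : ℕ → ℂ) {M : ℝ} (hM0 : 0 ≤ M)
    (hM : ∀ r, ∑ q, ‖∑ j ∈ s, b j * (e r j * star (e q j))‖ ≤ M) :
    ∑ r, ‖∑ j ∈ J, a j * e r j‖ ^ 2 ≤ 2 * M * ∑ j ∈ J, ‖a j‖ ^ 2 := by
  set v : ι → ℂ := fun r => ∑ j ∈ J, a j * e r j with hv
  set d : ℕ → ℂ := fun j => ∑ r, star (v r) * e r j with hd
  set k : ι → ι → ℂ := fun r q => ∑ j ∈ s, b j * (e r j * star (e q j)) with hk
  set Q := ∑ r, ‖v r‖ ^ 2 with hQ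
  have hQ0 : 0 ≤ Q := Finset.sum_nonneg fun r _ => by positivity
  have hsymm : ∀ r q, ‖k r q‖ = ‖k q r‖ := fun r q => by
    rw [← norm_star (k q r)]
    simp only [hk, star_sum, star_mul', star_star]
    congr 1
    refine Finset.sum_congr rfl fun j _ => ?_
    rw [show star ((b j : ℝ) : ℂ) = b j from conj_ofReal _]
    ring
  have hQd : (Q : ℂ) = ∑ j ∈ J, a j * d j := by
    simp only [hQ, hd, Finset.mul_sum]
    rw [Finset.sum_comm]
    push_cast
    refine Finset.sum_congr rfl fun r _ => ?_
    rw [← conj_mul']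
    nth_rewrite 2 [hv]
    rw [Finset.mul_sum]
    refine Finset.sum_congr rfl fun j _ => ?_
    simp only [starRingEnd_apply]
    ring
  have hQ1 : Q ≤ ∑ j ∈ J, ‖a j‖ * ‖d j‖ := by
    have : ‖(Q : ℂ)‖ = Q := by rw [norm_real, Real.norm_of_nonneg hQ0]
    rw [← this, hQd]
    exact (norm_sum_le _ _).trans (Finset.sum_le_sum fun j _ => norm_mul_le _ _)
  have hQ2 : Q ^ 2 ≤ (∑ j ∈ J, ‖a j‖ ^ 2) * ∑ j ∈ J, ‖d j‖ ^ 2 :=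
    (pow_le_pow_left₀ hQ0 hQ1 2).trans (Finset.sum_mul_sq_le_sq_mul_sq _ _ _)
  have hd1 : ∑ j ∈ J, ‖d j‖ ^ 2 ≤ 2 * ∑ j ∈ s, b j * ‖d j‖ ^ 2 := by
    rw [Finset.mul_sum]
    refine (Finset.sum_le_sum fun j hj => ?_).trans
      (Finset.sum_le_sum_of_subset_of_nonneg hJs fun j hj _ => ?_)
    · have := hbJ j hj
      nlinarith [sq_nonneg ‖d j‖]
    · have := hb j hj
      positivity
  have hd2 : ((∑ j ∈ s, b j * ‖d j‖ ^ 2 : ℝ) : ℂ) =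
      ∑ r, ∑ q, star (v r) * v q * k r q := by
    push_cast
    have h1 : ∀ j, (b j : ℂ) * (‖d j‖ : ℂ) ^ 2 =
        ∑ r, ∑ q, star (v r) * v q * (b j * (e r j * star (e q j))) := fun j => by
      rw [← mul_conj', starRingEnd_apply]
      simp only [hd, star_sum, star_mul', star_star]
      rw [Finset.sum_mul_sum, Finset.mul_sum]
      refine Finset.sum_congr rfl fun r _ => ?_
      rw [Finset.mul_sum]
      refine Finset.sum_congr rfl fun q _ => ?_
      ring
    simp only [h1, hk, Finset.mul_sum]
    rw [Finset.sum_comm]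
    refine Finset.sum_congr rfl fun r _ => ?_
    rw [Finset.sum_comm]
  have hd3 : ∑ j ∈ s, b j * ‖d j‖ ^ 2 ≤ M * Q := by
    have h0 : 0 ≤ ∑ j ∈ s, b j * ‖d j‖ ^ 2 :=
      Finset.sum_nonneg fun j hj => mul_nonneg (hb j hj) (sq_nonneg _)
    have h1 : ‖((∑ j ∈ s, b j * ‖d j‖ ^ 2 : ℝ) : ℂ)‖ = ∑ j ∈ s, b j * ‖d j‖ ^ 2 := by
      rw [norm_real, Real.norm_of_nonneg h0]
    rw [← h1, hd2]
    have h2 : ∑ r, ∑ q, ‖v r‖ ^ 2 * ‖k r q‖ ≤ M * Q := by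
      rw [hQ, Finset.mul_sum]
      refine Finset.sum_le_sum fun r _ => ?_
      rw [← Finset.mul_sum, mul_comm]
      exact mul_le_mul_of_nonneg_right (hM r) (sq_nonneg _)
    have h3 : ∑ r, ∑ q, ‖v q‖ ^ 2 * ‖k r q‖ ≤ M * Q := by
      rw [Finset.sum_comm]
      simpa only [hsymm] using h2
    have h4 : ‖∑ r, ∑ q, star (v r) * v q * k r q‖ ≤
        ∑ r, ∑ q, (‖v r‖ ^ 2 * ‖k r q‖ + ‖v q‖ ^ 2 * ‖k r q‖) / 2 := by
      refine (norm_sum_le _ _).trans (Finset.sum_le_sum fun r _ => ?_)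
      refine (norm_sum_le _ _).trans (Finset.sum_le_sum fun q _ => ?_)
      rw [norm_mul, norm_mul, norm_star]
      nlinarith [mul_nonneg (sq_nonneg (‖v r‖ - ‖v q‖)) (norm_nonneg (k r q))]
    simp only [← Finset.sum_div, Finset.sum_add_distrib] at h4
    linarith
  have hG : 0 ≤ ∑ j ∈ J, ‖a j‖ ^ 2 := Finset.sum_nonneg fun j _ => by positivity
  have hfinal : Q ^ 2 ≤ (2 * M * ∑ j ∈ J, ‖a j‖ ^ 2) * Q := by
    refine hQ2.trans ?_
    nlinarith [mul_le_mul_of_nonneg_left (hd1.trans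
      (mul_le_mul_of_nonneg_left hd3 zero_le_two)) hG]
  rcases hQ0.eq_or_lt with h | h
  · rw [← h]
    positivity
  · rw [sq] at hfinal
    exact le_of_mul_le_mul_right hfinal h

lemma cpow_neg_I_mul_star {a : ℝ} (ha : 0 < a) (t u : ℝ) :
    (a : ℂ) ^ (-(I * (t : ℂ))) * star ((a : ℂ) ^ (-(I * (u : ℂ)))) =
      (a : ℂ) ^ (-(I * ((t - u : ℝ) : ℂ))) := by
  have harg : arg (a : ℂ) ≠ Real.pi := by
    rw [arg_ofReal_of_nonneg ha.le]
    exact Real.pi_pos.ne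
  have h1 : star ((a : ℂ) ^ (-(I * (u : ℂ)))) = (a : ℂ) ^ (I * (u : ℂ)) := by
    have h := cpow_conj (a : ℂ) (-(I * (u : ℂ))) harg
    simp only [map_neg, map_mul, conj_I, conj_ofReal, neg_mul, neg_neg] at h
    rw [h]
    rfl
  rw [h1, ← cpow_add _ _ (by exact_mod_cast ha.ne')]
  congr 1
  push_cast
  ring

lemma BeurlingSystem.one_le_n (S : BeurlingSystem) (j : ℕ) : 1 ≤ S.n j := by
  obtain ⟨k, rfl⟩ := S.equiv.surjective j
  rw [S.n_eq]
  exact Finset.prod_induction _ (fun x : ℝ => 1 ≤ x)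
    (fun _ _ ha hb => one_le_mul_of_one_le_of_one_le ha hb) le_rfl
    fun i _ => one_le_pow₀ (S.one_lt_p.le.trans (S.mono_p (Nat.zero_le i)))

lemma BeurlingSystem.finite_le (S : BeurlingSystem) {A θ : ℝ} (hA : 0 < A) (hθ1 : θ < 1)
    (hwb : (fun x : ℝ => (S.Nint x : ℝ) - A * x) =O[atTop] fun x : ℝ => x ^ θ) (x : ℝ) :
    {j | S.n j ≤ x}.Finite := by
  have hlittle : (fun x : ℝ => (S.Nint x : ℝ) - A * x) =o[atTop] fun x : ℝ => x := by
    refine hwb.trans_isLittleO ?_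
    refine isLittleO_of_tendsto' ((eventually_ne_atTop 0).mono fun y hy h => absurd h hy) ?_
    refine (tendsto_rpow_neg_atTop (sub_pos.2 hθ1)).congr' ?_
    filter_upwards [eventually_gt_atTop 0] with y hy
    rw [neg_sub, Real.rpow_sub_one hy.ne']
  obtain ⟨y, hy, hxy, hy0⟩ := ((hlittle.def (half_pos hA)).and
    ((eventually_ge_atTop x).and (eventually_gt_atTop 0))).exists
  rw [Real.norm_eq_abs, Real.norm_eq_abs, abs_of_pos hy0] at hy
  have h1 := (abs_le.1 hy).1
  have h2 : (0 : ℝ) < S.Nint y := by nlinarith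
  have h3 : 0 < {j | S.n j ≤ y}.ncard := by exact_mod_cast h2
  exact (finite_of_ncard_pos h3).subset fun j hj => le_trans hj hxy

lemma BeurlingSystem.exists_count_bound (S : BeurlingSystem) {A θ κ : ℝ} (hA : 0 < A)
    (hκ : 0 < κ) (hθκ : θ ≤ κ) (hθ1 : θ < 1)
    (hwb : (fun x : ℝ => (S.Nint x : ℝ) - A * x) =O[atTop] fun x : ℝ => x ^ θ) :
    ∃ C : ℝ, ∀ x, 1 ≤ x → |({j | S.n j ≤ x}.ncard : ℝ) - A * x| ≤ C * x ^ κ := by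
  obtain ⟨c, hc, hbd⟩ := hwb.exists_pos
  obtain ⟨x₀, hx₀⟩ := eventually_atTop.1 hbd.bound
  refine ⟨c + (S.Nint x₀ + A * |x₀|), fun x hx => ?_⟩
  have hxκ : 1 ≤ x ^ κ := Real.one_le_rpow hx hκ.le
  have hnn : 0 ≤ (S.Nint x₀ : ℝ) + A * |x₀| := by positivity
  rcases le_total x₀ x with h | h
  · have h1 := hx₀ x h
    rw [Real.norm_eq_abs, Real.norm_of_nonneg (by positivity)] at h1
    have h2 : x ^ θ ≤ x ^ κ := Real.rpow_le_rpow_of_exponent_le hx hθκ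
    refine (show _ ≤ _ from h1).trans ?_
    nlinarith
  · have h1 : {j | S.n j ≤ x}.ncard ≤ S.Nint x₀ :=
      ncard_le_ncard (fun j hj => le_trans hj h) (S.finite_le hA hθ1 hwb x₀)
    have h2 : ({j | S.n j ≤ x}.ncard : ℝ) ≤ S.Nint x₀ := by exact_mod_cast h1
    have h3 : A * x ≤ A * |x₀| := by
      gcongr
      exact h.trans (le_abs_self _)
    have h4 : (0 : ℝ) ≤ ({j | S.n j ≤ x}.ncard : ℝ) := Nat.cast_nonneg _
    have h5 : 0 ≤ A * x := by positivity
    have h6 : |({j | S.n j ≤ x}.ncard : ℝ) - A * x| ≤ S.Nint x₀ + A * |x₀| := by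
      rw [abs_le]
      constructor <;> linarith
    nlinarith

/-- Estimate (5.8): the Halász–Montgomery inequality for Beurling systems, conditional
on a subconvexity bound `|ζ_𝒫((1+θ)/2+it)| ≪_B (1+|t|)^B` with `0 < B ≤ 1/2`. -/
theorem halasz_montgomery_subconvexity
    (θ : ℝ) (hθ0 : 0 ≤ θ) (hθ1 : θ < 1) (S : BeurlingSystem)
    (A : ℝ) (hA : 0 < A)
    (hwb : (fun x : ℝ => (S.Nint x : ℝ) - A * x) =O[atTop] fun x : ℝ => x ^ θ)
    (Z : ℂ → ℂ) (hZ : S.IsZeta θ A Z)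
    (B : ℝ) (hB0 : 0 < B) (hB : B ≤ 1 / 2)
    (hsub : ∃ CB : ℝ, ∀ t : ℝ,
      ‖Z ((((1 + θ) / 2 : ℝ) : ℂ) + Complex.I * (t : ℂ))‖ ≤ CB * (1 + |t|) ^ B) :
    ∃ C : ℝ, ∀ (T N : ℝ) (R : ℕ) (t : Fin R → ℝ) (a : ℕ → ℂ),
      2 ≤ T → 2 ≤ N →
      (∀ r, t r ∈ Set.Icc (0:ℝ) T) →
      (∀ r s : Fin R, r ≠ s → 1 ≤ |t r - t s|) →
      (∑ r : Fin R, ‖∑' j : ℕ, Set.indicator {j : ℕ | N < S.n j ∧ S.n j ≤ 2 * N}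
          (fun j => a j * (S.n j : ℂ) ^ (-(Complex.I * ((t r : ℝ) : ℂ)))) j‖ ^ 2)
        ≤ C * (N + N ^ ((1 + θ) / 2) * T ^ B * (R : ℝ)) *
            ∑' j : ℕ, Set.indicator {j : ℕ | N < S.n j ∧ S.n j ≤ 2 * N}
              (fun j => ‖a j‖ ^ 2) j := by
  obtain ⟨CB, hCB⟩ := hsub
  have hκ : 0 < (1 + 3 * θ) / 4 := by linarith
  have hκ1 : (1 + 3 * θ) / 4 < 1 := by linarith
  have hfin := S.finite_le hA hθ1 hwb
  obtain ⟨C, hE⟩ := S.exists_count_bound hA hκ (by linarith) hθ1 hwb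
  obtain ⟨K, hK0, hK⟩ := exists_norm_fejerSum_le S.mono_n hfin S.one_le_n hA hκ hκ1 hE hZ.1
    (hZ.2.mono fun s (hs : _ < s.re) => show θ < s.re by linarith)
    (σ := (1 + θ) / 2) (by linarith) (by linarith) (by linarith) hB0.le hB hCB
  obtain ⟨W, hW0, hW⟩ := exists_sum_wellSpaced_le
  refine ⟨2 * (K * (4 * W + 8)), fun T N R t a hT hN htT ht => ?_⟩
  have hN0 : 0 < N := by linarith
  have hX : 0 < 4 * N := by positivity
  set s := (hfin (4 * N)).toFinset with hs
  set J := (hfin (2 * N)).toFinset.filter fun j => N < S.n j with hJ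
  have hJmem : ∀ j, j ∈ J ↔ j ∈ {j : ℕ | N < S.n j ∧ S.n j ≤ 2 * N} := fun j => by
    simp [hJ, and_comm]
  have hsmem : ∀ j, j ∈ s ↔ S.n j ≤ 4 * N := fun j => by simp [hs]
  have htsum : ∀ {E : Type} [AddCommMonoid E] [TopologicalSpace E] (f : ℕ → E),
      ∑' j, Set.indicator {j : ℕ | N < S.n j ∧ S.n j ≤ 2 * N} f j = ∑ j ∈ J, f j := fun f => by
    rw [tsum_eq_sum (s := J) fun j hj => Set.indicator_of_notMem (by rwa [← hJmem]) f]
    exact Finset.sum_congr rfl fun j hj => Set.indicator_of_mem ((hJmem j).1 hj) f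
  simp only [htsum]
  have hker : ∀ r q, ∑ j ∈ s, ((max (1 - S.n j * (1 / (4 * N))) 0 : ℝ) : ℂ) *
      ((S.n j : ℂ) ^ (-(I * (t r : ℂ))) * star ((S.n j : ℂ) ^ (-(I * (t q : ℂ))))) =
      fejerSum S.n (t r - t q) (1 / (4 * N)) := fun r q => by
    rw [fejerSum_eq_sum (t r - t q) (s := s) fun j hj => ?_]
    · refine Finset.sum_congr rfl fun j _ => ?_
      rw [cpow_neg_I_mul_star (zero_lt_one.trans_le (S.one_le_n j)), mul_comm]
    · rw [hsmem, not_le] at hj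
      rw [mul_one_div, le_div_iff₀ hX, one_mul]
      exact hj.le
  have hσ4 : (4 * N) ^ ((1 + θ) / 2) ≤ 4 * N ^ ((1 + θ) / 2) := by
    rw [Real.mul_rpow (by norm_num) hN0.le]
    gcongr
    calc (4 : ℝ) ^ ((1 + θ) / 2) ≤ 4 ^ (1 : ℝ) :=
          Real.rpow_le_rpow_of_exponent_le (by norm_num) (by linarith)
      _ = 4 := Real.rpow_one 4
  have hTB : (1 + T) ^ B ≤ 2 * T ^ B := by
    calc (1 + T) ^ B ≤ (2 * T) ^ B := by gcongr; linarith
      _ = 2 ^ B * T ^ B := Real.mul_rpow (by norm_num) (by linarith)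
      _ ≤ 2 ^ (1 : ℝ) * T ^ B := by
          gcongr
          · norm_num
          · linarith
      _ = _ := by rw [Real.rpow_one]
  have hT0 : 0 ≤ T := by linarith
  set P := N ^ ((1 + θ) / 2) * T ^ B with hP
  have hP0 : 0 ≤ P := by positivity
  have hrow : ∀ r, ∑ q, ‖∑ j ∈ s, ((max (1 - S.n j * (1 / (4 * N))) 0 : ℝ) : ℂ) *
      ((S.n j : ℂ) ^ (-(I * (t r : ℂ))) * star ((S.n j : ℂ) ^ (-(I * (t q : ℂ)))))‖ ≤
      K * (4 * W + 8) * (N + P * R) := fun r => by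
    simp only [hker]
    calc ∑ q, ‖fejerSum S.n (t r - t q) (1 / (4 * N))‖
        ≤ ∑ q, (K * (4 * N) * (1 / (1 + (t r - t q) ^ 2)) + K * (8 * P)) := by
          refine Finset.sum_le_sum fun q _ => (hK _ _ hX).trans ?_
          have h1 : |t r - t q| ≤ T := by
            have h2 := htT r
            have h3 := htT q
            rw [abs_le]
            constructor <;> linarith [h2.1, h2.2, h3.1, h3.2]
          have h2 : (1 + |t r - t q|) ^ B ≤ 2 * T ^ B :=
            (Real.rpow_le_rpow (by positivity) (by linarith) hB0.le).trans hTB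
          have h3 : (4 * N) ^ ((1 + θ) / 2) * (1 + |t r - t q|) ^ B ≤ 8 * P := by
            calc _ ≤ (4 * N ^ ((1 + θ) / 2)) * (2 * T ^ B) := by gcongr
              _ = 8 * P := by ring
          rw [mul_add, ← mul_assoc]
          gcongr
      _ = K * (4 * N) * ∑ q, 1 / (1 + (t r - t q) ^ 2) + R * (K * (8 * P)) := by
          rw [Finset.sum_add_distrib, ← Finset.mul_sum, Finset.sum_const, Finset.card_univ,
            Fintype.card_fin, nsmul_eq_mul]
      _ ≤ K * (4 * N) * W + R * (K * (8 * P)) := by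
          gcongr
          exact hW R t ht r
      _ ≤ _ := by
          have h1 : 0 ≤ K * W * (P * R) := by positivity
          have h2 : 0 ≤ K * N := by positivity
          nlinarith
  have hmain := sum_norm_sq_le_of_row_sums (J := J) (s := s)
    (fun j hj => (hsmem j).2 (((hJmem j).1 hj).2.trans (by linarith)))
    (fun j => max (1 - S.n j * (1 / (4 * N))) 0) (fun j _ => le_max_right _ _)
    (fun j hj => ?_) (fun r j => (S.n j : ℂ) ^ (-(I * (t r : ℂ)))) a
    (M := K * (4 * W + 8) * (N + P * R)) (by positivity) hrow
  · refine hmain.trans (le_of_eq ?_)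
    ring
  · refine le_max_of_le_left ?_
    have h1 : S.n j * (1 / (4 * N)) ≤ 1 / 2 := by
      rw [mul_one_div, div_le_iff₀ hX]
      linarith [((hJmem j).1 hj).2]
    linarith
end
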